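/- arXiv:math/0605237 — 3 statements merged into one kernel-verified Lean document; each statement's English description precedes it below -/
import Mathlib

section
/- Schwartz-type lemma for free holomorphic functions: Let S_1,…,S_n be isometries with pairwise orthogonal ranges and vacuum vector ξ on a complex Hilbert space E. Let m ≥ 1 and let a : F_n^+ → ℂ satisfy: (a) limsup_{k→∞}(∑_{|α|=k}|a_α|²)^{1/(2k)} ≤ 1; (b) a_β = 0 for every word β with |β| ≤ m−1; and (c) ‖∑_{k=0}^∞ r^k ∑_{|α|=k} a_α S_α‖ ≤ 1 for every r ∈ [0,1). Then: (1) for every complex Hilbert space K and every n-tuple X of bounded operators on K with ‖X‖_row < 1, the series f(X) := ∑_{k=0}^∞ ∑_{|α|=k} a_α X_α converges in operator norm and ‖f(X)‖ ≤ ‖∑_{|β|=m} X_β X_β*‖^{1/2} ≤ (‖X‖_row)^m; and (2) (∑_{|α|=k}|a_α|²)^{1/2} ≤ 1 for every k ≥ m. -/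
open Filter MeasureTheory
open scoped ENNReal

variable {n : ℕ}

/-- The operator `X_α` associated to a word `α` in the free monoid `F_n^+`
(words are encoded as lists over `Fin n`). -/
noncomputable def wordProd {H : Type*} [NormedAddCommGroup H] [NormedSpace ℂ H]
    (X : Fin n → H →L[ℂ] H) (α : List (Fin n)) : H →L[ℂ] H :=
  (α.map X).prod

/-- The level-`k` piece `∑_{|α|=k} a_α X_α` of a free power series (words of length `k`
are encoded as functions `Fin k → Fin n`). -/
noncomputable def lvlOp {H : Type*} [NormedAddCommGroup H] [NormedSpace ℂ H]
    (a : List (Fin n) → ℂ) (X : Fin n → H →L[ℂ] H) (k : ℕ) : H →L[ℂ] H :=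
  ∑ w : Fin k → Fin n, a (List.ofFn w) • wordProd X (List.ofFn w)

/-- `(∑_{|α|=k} |a_α|²)^{1/2}`. -/
noncomputable def lvlCoef (a : List (Fin n) → ℂ) (k : ℕ) : ℝ :=
  Real.sqrt (∑ w : Fin k → Fin n, ‖a (List.ofFn w)‖ ^ 2)

/-- `1/R = limsup_k (∑_{|α|=k} |a_α|²)^{1/(2k)}`, as an extended nonnegative real;
the radius of convergence is `(radiusInv a)⁻¹ ∈ [0,∞]`. -/
noncomputable def radiusInv (a : List (Fin n) → ℂ) : ℝ≥0∞ :=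
  Filter.limsup (fun k : ℕ => ENNReal.ofReal (lvlCoef a k ^ (1 / (2 * (k : ℝ))))) Filter.atTop

/-- The row norm `‖X_1X_1^* + ⋯ + X_nX_n^*‖^{1/2}`. -/
noncomputable def rowNorm {H : Type*} [NormedAddCommGroup H] [InnerProductSpace ℂ H]
    [CompleteSpace H] (X : Fin n → H →L[ℂ] H) : ℝ :=
  Real.sqrt ‖∑ i, X i ∘L ContinuousLinearMap.adjoint (X i)‖

/-- The joint spectral radius `limsup_k ‖∑_{|α|=k} X_α X_α^*‖^{1/(2k)}`,
as an extended nonnegative real. -/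
noncomputable def jsr {H : Type*} [NormedAddCommGroup H] [InnerProductSpace ℂ H]
    [CompleteSpace H] (X : Fin n → H →L[ℂ] H) : ℝ≥0∞ :=
  Filter.limsup (fun k : ℕ => ENNReal.ofReal
    (‖∑ w : Fin k → Fin n, wordProd X (List.ofFn w) ∘L
        ContinuousLinearMap.adjoint (wordProd X (List.ofFn w))‖ ^ (1 / (2 * (k : ℝ))))) Filter.atTop


namespace Schw

open ContinuousLinearMap

/-- words of length `k` -/
def W (n k : ℕ) : Finset (List (Fin n)) :=
  (Finset.univ : Finset (Fin k → Fin n)).map ⟨fun w => List.ofFn w, List.ofFn_injective⟩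

lemma mem_W {n k : ℕ} {α : List (Fin n)} : α ∈ W n k ↔ α.length = k := by
  simp only [W, Finset.mem_map, Finset.mem_univ, true_and, Function.Embedding.coeFn_mk]
  constructor
  · rintro ⟨w, rfl⟩; simp
  · rintro rfl; exact ⟨α.get, List.ofFn_get α⟩

lemma sum_W {n k : ℕ} {M : Type*} [AddCommMonoid M] (f : List (Fin n) → M) :
    ∑ α ∈ W n k, f α = ∑ w : Fin k → Fin n, f (List.ofFn w) := by
  simp [W]

/-- words of length at most `N` -/
def B (n N : ℕ) : Finset (List (Fin n)) := (Finset.range (N + 1)).biUnion (W n)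

lemma mem_B {n N : ℕ} {α : List (Fin n)} : α ∈ B n N ↔ α.length ≤ N := by
  simp [B, mem_W]

lemma sum_B {n N : ℕ} {M : Type*} [AddCommMonoid M] (f : List (Fin n) → M) :
    ∑ α ∈ B n N, f α = ∑ k ∈ Finset.range (N + 1), ∑ α ∈ W n k, f α := by
  rw [B, Finset.sum_biUnion]
  intro i _ j _ hij
  rw [Function.onFun, Finset.disjoint_left]
  intro α h1 h2
  exact hij ((mem_W.1 h1).symm.trans (mem_W.1 h2))

lemma sum_W_succ {n k : ℕ} {M : Type*} [AddCommMonoid M] (f : List (Fin n) → M) :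
    ∑ α ∈ W n (k + 1), f α = ∑ α ∈ W n k, ∑ i, f (α ++ [i]) := by
  rw [← Finset.sum_product']
  symm
  refine Finset.sum_bij (fun p _ => p.1 ++ [p.2]) ?_ ?_ ?_ ?_
  · rintro ⟨α, i⟩ h
    simp only [Finset.mem_product, mem_W] at h
    simp [mem_W, h.1]
  · rintro ⟨α, i⟩ _ ⟨β, j⟩ _ h
    have := List.append_inj' h rfl
    simp at this
    simp [this]
  · intro α h
    rw [mem_W] at h
    have hne : α ≠ [] := by rintro rfl; simp at h
    refine ⟨(α.dropLast, α.getLast hne), ?_, ?_⟩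
    · simp [mem_W, h]
    · exact List.dropLast_append_getLast hne
  · intros; rfl

section ops
variable {n : ℕ} {H : Type*} [NormedAddCommGroup H] [InnerProductSpace ℂ H] [CompleteSpace H]

lemma wordProd_append (X : Fin n → H →L[ℂ] H) (α β : List (Fin n)) :
    wordProd X (α ++ β) = wordProd X α * wordProd X β := by
  simp [wordProd]

lemma adj_append (X : Fin n → H →L[ℂ] H) (α β : List (Fin n)) (x : H) :
    adjoint (wordProd X (α ++ β)) x = adjoint (wordProd X β) (adjoint (wordProd X α) x) := by
  rw [wordProd_append, ContinuousLinearMap.mul_def, adjoint_comp]; rfl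

lemma adj_smul (c : ℂ) (T : H →L[ℂ] H) (x : H) :
    adjoint (c • T) x = (starRingEnd ℂ c) • adjoint T x := by
  rw [LinearIsometryEquiv.map_smulₛₗ]; rfl

lemma wordProd_single (X : Fin n → H →L[ℂ] H) (i : Fin n) : wordProd X [i] = X i := by
  simp [wordProd]

lemma wordProd_nil (X : Fin n → H →L[ℂ] H) : wordProd X [] = 1 := by
  simp [wordProd]

lemma lvlOp_eq (a : List (Fin n) → ℂ) (X : Fin n → H →L[ℂ] H) (k : ℕ) :
    lvlOp a X k = ∑ α ∈ W n k, a α • wordProd X α := by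
  rw [sum_W]; rfl

lemma lvlCoef_eq (a : List (Fin n) → ℂ) (k : ℕ) :
    lvlCoef a k = Real.sqrt (∑ α ∈ W n k, ‖a α‖ ^ 2) := by
  rw [sum_W]; rfl

/-- `∑_{|α|=k} ‖X_α^* x‖²` -/
noncomputable def Q (X : Fin n → H →L[ℂ] H) (k : ℕ) (x : H) : ℝ :=
  ∑ α ∈ W n k, ‖adjoint (wordProd X α) x‖ ^ 2

lemma Q_nonneg (X : Fin n → H →L[ℂ] H) (k : ℕ) (x : H) : 0 ≤ Q X k x :=
  Finset.sum_nonneg fun _ _ => by positivity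

lemma Q_zero (X : Fin n → H →L[ℂ] H) (x : H) : Q X 0 x = ‖x‖ ^ 2 := by
  rw [Q, sum_W]; simp [wordProd_nil, ← star_eq_adjoint]

lemma Q_succ (X : Fin n → H →L[ℂ] H) (k : ℕ) (x : H) :
    Q X (k + 1) x = ∑ α ∈ W n k, ∑ i, ‖adjoint (X i) (adjoint (wordProd X α) x)‖ ^ 2 := by
  rw [Q, sum_W_succ]; simp only [adj_append, wordProd_single]

lemma Q_le (X : Fin n → H →L[ℂ] H) {ρ : ℝ} 
    (h : ∀ x, ∑ i, ‖adjoint (X i) x‖ ^ 2 ≤ ρ ^ 2 * ‖x‖ ^ 2) (k : ℕ) (x : H) :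
    Q X k x ≤ (ρ ^ k) ^ 2 * ‖x‖ ^ 2 := by
  induction k with
  | zero => simp [Q_zero]
  | succ k ih =>
    rw [Q_succ]
    calc _ ≤ ∑ α ∈ W n k, ρ ^ 2 * ‖adjoint (wordProd X α) x‖ ^ 2 :=
          Finset.sum_le_sum fun α _ => h _
      _ = ρ ^ 2 * Q X k x := by rw [Q, Finset.mul_sum]
      _ ≤ ρ ^ 2 * ((ρ ^ k) ^ 2 * ‖x‖ ^ 2) := by gcongr
      _ = _ := by ring

lemma norm_sum_le {ι : Type*} (s : Finset ι) (T : ι → H →L[ℂ] H) {C : ℝ} (hC : 0 ≤ C)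
    (h : ∀ x, ∑ i ∈ s, ‖adjoint (T i) x‖ ^ 2 ≤ C ^ 2 * ‖x‖ ^ 2) :
    ‖∑ i ∈ s, T i ∘L adjoint (T i)‖ ≤ C ^ 2 := by
  have hsq : ∀ x, Real.sqrt (∑ i ∈ s, ‖adjoint (T i) x‖ ^ 2) ≤ C * ‖x‖ := fun x =>
    Real.sqrt_le_iff.2 ⟨by positivity, by rw [mul_pow]; exact h x⟩
  refine ContinuousLinearMap.opNorm_le_of_re_inner_le (by positivity) fun x y hx hy => ?_
  rw [_root_.sum_apply, sum_inner]
  refine (RCLike.re_le_norm _).trans ((_root_.norm_sum_le _ _).trans ?_)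
  calc _ ≤ ∑ i ∈ s, ‖adjoint (T i) x‖ * ‖adjoint (T i) y‖ := by
        refine Finset.sum_le_sum fun i _ => ?_
        rw [ContinuousLinearMap.comp_apply, ← adjoint_inner_right]
        exact norm_inner_le_norm _ _
    _ ≤ _ := Real.sum_mul_le_sqrt_mul_sqrt _ _ _
    _ ≤ (C * ‖x‖) * (C * ‖y‖) := by gcongr <;> apply hsq
    _ = C ^ 2 := by rw [hx, hy]; ring

lemma sum_le_norm {ι : Type*} (s : Finset ι) (T : ι → H →L[ℂ] H) (x : H) :
    ∑ i ∈ s, ‖adjoint (T i) x‖ ^ 2 ≤ ‖∑ i ∈ s, T i ∘L adjoint (T i)‖ * ‖x‖ ^ 2 := by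
  have h1 : (∑ i ∈ s, ‖adjoint (T i) x‖ ^ 2 : ℝ) =
      RCLike.re (inner ℂ ((∑ i ∈ s, T i ∘L adjoint (T i)) x) x) := by
    rw [_root_.sum_apply, sum_inner, map_sum]
    refine Finset.sum_congr rfl fun i _ => ?_
    rw [ContinuousLinearMap.comp_apply, ← adjoint_inner_right, ← norm_sq_eq_re_inner]
  rw [h1]
  refine (RCLike.re_le_norm _).trans ((norm_inner_le_norm _ _).trans ?_)
  rw [pow_two, ← mul_assoc]
  gcongr
  exact le_opNorm _ _

lemma lvlOp_norm_le (a : List (Fin n) → ℂ) (X : Fin n → H →L[ℂ] H) {ρ : ℝ} (hρ : 0 ≤ ρ)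
    (h : ∀ x, ∑ i, ‖adjoint (X i) x‖ ^ 2 ≤ ρ ^ 2 * ‖x‖ ^ 2) (k : ℕ) :
    ‖lvlOp a X k‖ ≤ lvlCoef a k * ρ ^ k := by
  have h0 : 0 ≤ lvlCoef a k := Real.sqrt_nonneg _
  rw [← (adjoint : (H →L[ℂ] H) ≃ₗᵢ⋆[ℂ] (H →L[ℂ] H)).norm_map]
  refine ContinuousLinearMap.opNorm_le_bound _ (by positivity) fun y => ?_
  rw [lvlOp_eq, map_sum, _root_.sum_apply]
  calc _ ≤ ∑ α ∈ W n k, ‖a α‖ * ‖adjoint (wordProd X α) y‖ := by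
        refine (_root_.norm_sum_le _ _).trans (Finset.sum_le_sum fun α _ => ?_)
        rw [adj_smul, norm_smul, RCLike.norm_conj]
    _ ≤ lvlCoef a k * Real.sqrt (Q X k y) := by
        rw [lvlCoef_eq]; exact Real.sum_mul_le_sqrt_mul_sqrt _ _ _
    _ ≤ lvlCoef a k * (ρ ^ k * ‖y‖) := by
        gcongr
        refine Real.sqrt_le_iff.2 ⟨by positivity, ?_⟩
        rw [mul_pow]; exact Q_le X h k y
    _ = _ := by ring

lemma summable_coef (a : List (Fin n) → ℂ) (ha : radiusInv a ≤ 1) {ρ : ℝ} (hρ : 0 ≤ ρ)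
    (hρ1 : ρ < 1) : Summable fun k => lvlCoef a k * ρ ^ k := by
  obtain ⟨s, hs1, hs⟩ : ∃ s : ℝ, 1 < s ∧ s ^ 2 * ρ < 1 := by
    have : ∀ᶠ s : ℝ in nhdsWithin 1 (Set.Ioi 1), s ^ 2 * ρ < 1 := by
      refine Filter.Eventually.filter_mono nhdsWithin_le_nhds ?_
      have hc : ContinuousAt (fun s : ℝ => s ^ 2 * ρ) 1 := by fun_prop
      exact hc.eventually_lt continuousAt_const (by simpa using hρ1)
    obtain ⟨s, h1, h2⟩ := (this.and self_mem_nhdsWithin).exists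
    exact ⟨s, h2, h1⟩
  have hlt : radiusInv a < ENNReal.ofReal s := lt_of_le_of_lt ha (by simpa using hs1)
  have hev := Filter.eventually_lt_of_limsup_lt hlt
  have hsum : Summable fun k : ℕ => (s ^ 2 * ρ) ^ k :=
    summable_geometric_of_lt_one (by positivity) hs
  refine Summable.of_norm_bounded_eventually_nat hsum ?_
  filter_upwards [hev, Filter.eventually_ge_atTop 1] with k hk hk1
  have h0 : 0 ≤ lvlCoef a k := Real.sqrt_nonneg _
  have hk' : lvlCoef a k ^ (1 / (2 * (k : ℝ))) ≤ s :=
    ((ENNReal.ofReal_lt_ofReal_iff (by linarith)).1 hk).le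
  have hkpos : (0 : ℝ) < k := by exact_mod_cast hk1
  have hle : lvlCoef a k ≤ s ^ (2 * k) := by
    calc lvlCoef a k = (lvlCoef a k ^ (1 / (2 * (k : ℝ)))) ^ (2 * k) := by
          rw [← Real.rpow_natCast, ← Real.rpow_mul h0]
          push_cast
          rw [one_div_mul_cancel (by positivity), Real.rpow_one]
      _ ≤ _ := by gcongr
  rw [Real.norm_of_nonneg (by positivity), mul_pow, ← pow_mul]
  gcongr

end ops

section star
variable {n : ℕ} {E : Type*} [NormedAddCommGroup E] [InnerProductSpace ℂ E] [CompleteSpace E]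

lemma S_row (S : Fin n → E →L[ℂ] E)
    (hS : ∀ i j, adjoint (S i) ∘L S j = if i = j then 1 else 0) (x : E) :
    ∑ i, ‖adjoint (S i) x‖ ^ 2 ≤ 1 ^ 2 * ‖x‖ ^ 2 := by
  set p := ∑ i, S i (adjoint (S i) x) with hp
  have hpi : ∀ i, adjoint (S i) p = adjoint (S i) x := by
    intro i
    rw [hp, map_sum]
    have : ∀ j, adjoint (S i) (S j (adjoint (S j) x)) =
        if i = j then adjoint (S j) x else 0 := by
      intro j
      have := congrArg (fun T => T (adjoint (S j) x)) (hS i j)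
      simp only [ContinuousLinearMap.comp_apply] at this
      rw [this]; split_ifs <;> simp
    simp [this]
  have hxp : inner ℂ p x = ((∑ i, ‖adjoint (S i) x‖ ^ 2 : ℝ) : ℂ) := by
    rw [hp, sum_inner]; push_cast
    refine Finset.sum_congr rfl fun i _ => ?_
    rw [← adjoint_inner_right, inner_self_eq_norm_sq_to_K]; rfl
  have hpp : inner ℂ p p = ((∑ i, ‖adjoint (S i) x‖ ^ 2 : ℝ) : ℂ) := by
    conv_lhs => rw [hp]
    rw [← hp, sum_inner]; push_cast
    refine Finset.sum_congr rfl fun i _ => ?_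
    rw [← adjoint_inner_right, hpi, inner_self_eq_norm_sq_to_K]; rfl
  have h1 : ‖p‖ ^ 2 = ∑ i, ‖adjoint (S i) x‖ ^ 2 := by
    have := inner_self_eq_norm_sq_to_K (𝕜 := ℂ) p
    rw [hpp] at this
    exact Complex.ofReal_injective (by simpa using this.symm)
  have h2 : ‖p‖ ^ 2 ≤ ‖p‖ * ‖x‖ := by
    have := norm_inner_le_norm (𝕜 := ℂ) p x
    rw [hxp, ← h1] at this
    simpa using this
  rw [← h1]
  have : ‖p‖ ≤ ‖x‖ := by
    by_contra! h
    have := norm_nonneg x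
    nlinarith
  rw [one_pow, one_mul]
  gcongr

lemma S_adj_cons (S : Fin n → E →L[ℂ] E)
    (hS : ∀ i j, adjoint (S i) ∘L S j = if i = j then 1 else 0) (i j : Fin n) (x : E) :
    adjoint (S i) (S j x) = if i = j then x else 0 := by
  have := congrArg (fun T => T x) (hS i j)
  simp only [ContinuousLinearMap.comp_apply] at this
  rw [this]; split_ifs <;> simp

lemma S_orth (S : Fin n → E →L[ℂ] E)
    (hS : ∀ i j, adjoint (S i) ∘L S j = if i = j then 1 else 0)
    (ξ : E) (hξ : ‖ξ‖ = 1) (hvac : ∀ i, adjoint (S i) ξ = 0) :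
    Orthonormal ℂ (fun α : List (Fin n) => wordProd S α ξ) := by
  have hc : ∀ i α, wordProd S (i :: α) ξ = S i (wordProd S α ξ) := by
    intro i α; simp [wordProd]
  rw [orthonormal_iff_ite]
  intro α
  induction α with
  | nil =>
    intro β
    cases β with
    | nil => simp [wordProd, inner_self_eq_norm_sq_to_K, hξ]
    | cons j β =>
      rw [hc, ← adjoint_inner_left]; simp [wordProd, hvac]
  | cons i α ih =>
    intro β
    cases β with
    | nil => rw [hc, ← adjoint_inner_right]; simp [wordProd, hvac]
    | cons j β =>
      rw [hc, hc, ← adjoint_inner_right, S_adj_cons S hS]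
      by_cases h : i = j
      · simp [h, ih]
      · simp [h]

/-- scalar version, `r < 1`. -/
lemma star_scalar_r (a : List (Fin n) → ℂ) (S : Fin n → E →L[ℂ] E)
    (hS : ∀ i j, adjoint (S i) ∘L S j = if i = j then 1 else 0)
    (ξ : E) (hξ : ‖ξ‖ = 1) (hvac : ∀ i, adjoint (S i) ξ = 0) (ha : radiusInv a ≤ 1)
    (r : ℝ) (hr0 : 0 ≤ r) (hr1 : r < 1)
    (hb : ‖∑' k : ℕ, ((r : ℂ) ^ k) • lvlOp a S k‖ ≤ 1)
    (N : ℕ) (c : List (Fin n) → ℂ) (hc : ∀ α, N < α.length → c α = 0) :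
    ∑ β ∈ B n N, ‖∑ γ ∈ B n N, (r : ℂ) ^ γ.length * (starRingEnd ℂ (a γ)) * c (γ ++ β)‖ ^ 2
      ≤ ∑ α ∈ B n N, ‖c α‖ ^ 2 := by
  have ho := S_orth S hS ξ hξ hvac
  set e : List (Fin n) → E := fun α => wordProd S α ξ with he
  have hsum : Summable fun k : ℕ => ((r : ℂ) ^ k) • lvlOp a S k := by
    refine Summable.of_norm_bounded (summable_coef a ha hr0 hr1) fun k => ?_
    have := lvlOp_norm_le a S zero_le_one (S_row S hS) k
    rw [norm_smul, norm_pow, Complex.norm_real, Real.norm_of_nonneg hr0, mul_comm]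
    rw [one_pow, mul_one] at this
    gcongr
  set T := ∑' k : ℕ, ((r : ℂ) ^ k) • lvlOp a S k with hT
  set u : E := ∑ α ∈ B n N, c α • e α with hu
  have heu : ∀ α, inner ℂ (e α) u = c α := by
    intro α
    by_cases h : α.length ≤ N
    · exact ho.inner_right_sum c (mem_B.2 h)
    · rw [hu, inner_sum, hc α (by omega)]
      refine Finset.sum_eq_zero fun β hβ => ?_
      rw [inner_smul_right, orthonormal_iff_ite.1 ho, if_neg, mul_zero]
      rintro rfl
      exact h (mem_B.1 hβ)
  have hnu : ‖u‖ ^ 2 = ∑ α ∈ B n N, ‖c α‖ ^ 2 := by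
    have h1 : inner ℂ u u = ((∑ α ∈ B n N, ‖c α‖ ^ 2 : ℝ) : ℂ) := by
      conv_lhs => rw [hu]
      rw [← hu, sum_inner]; push_cast
      refine Finset.sum_congr rfl fun α _ => ?_
      rw [inner_smul_left, heu, Complex.conj_mul']
    have := inner_self_eq_norm_sq_to_K (𝕜 := ℂ) u
    rw [h1] at this
    exact Complex.ofReal_injective (by simpa using this.symm)
  have hTu : ‖adjoint T u‖ ≤ ‖u‖ := by
    refine (le_opNorm _ _).trans ?_
    rw [(adjoint : (E →L[ℂ] E) ≃ₗᵢ⋆[ℂ] (E →L[ℂ] E)).norm_map]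
    exact mul_le_of_le_one_left (norm_nonneg _) hb
  have hin : ∀ β, inner ℂ (e β) (adjoint T u) =
      ∑ γ ∈ B n N, (r : ℂ) ^ γ.length * (starRingEnd ℂ (a γ)) * c (γ ++ β) := by
    intro β
    rw [adjoint_inner_right]
    have h1 : HasSum (fun k : ℕ => inner ℂ ((((r : ℂ) ^ k) • lvlOp a S k) (e β)) u)
        (inner ℂ (T (e β)) u) := by
      have h2 : HasSum (fun k : ℕ => (((r : ℂ) ^ k) • lvlOp a S k) (e β)) (T (e β)) :=
        hsum.hasSum.mapL (ContinuousLinearMap.apply ℂ E (e β))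
      have h3 := h2.mapL (innerSL ℂ u)
      have h4 := Complex.hasSum_conj'.2 h3
      simpa [mul_comm] using h4
    have h5 : ∀ k : ℕ, inner ℂ ((((r : ℂ) ^ k) • lvlOp a S k) (e β)) u =
        ∑ γ ∈ W n k, (r : ℂ) ^ γ.length * (starRingEnd ℂ (a γ)) * c (γ ++ β) := by
      intro k
      rw [lvlOp_eq, _root_.smul_apply, inner_smul_left, _root_.sum_apply,
        sum_inner, Finset.mul_sum]
      refine Finset.sum_congr rfl fun γ hγ => ?_
      have : wordProd S γ (e β) = e (γ ++ β) := by
        simp [he, wordProd_append]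
      rw [_root_.smul_apply, inner_smul_left, this, heu, mem_W.1 hγ]
      simp [mul_assoc]
    simp only [h5] at h1
    rw [sum_B]
    refine h1.unique (hasSum_sum_of_ne_finset_zero fun k hk => Finset.sum_eq_zero fun γ hγ => ?_)
    rw [hc, mul_zero]
    rw [mem_W] at hγ
    simp at hk ⊢
    omega
  calc _ = ∑ β ∈ B n N, ‖inner ℂ (e β) (adjoint T u)‖ ^ 2 := by simp only [hin]
    _ ≤ ‖adjoint T u‖ ^ 2 := ho.sum_inner_products_le _
    _ ≤ ‖u‖ ^ 2 := by gcongr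
    _ = _ := hnu

/-- the property of coefficients that we need -/
def Contr (a : List (Fin n) → ℂ) : Prop :=
  ∀ (N : ℕ) (c : List (Fin n) → ℂ), (∀ α, N < α.length → c α = 0) →
    ∑ β ∈ B n N, ‖∑ γ ∈ B n N, (starRingEnd ℂ (a γ)) * c (γ ++ β)‖ ^ 2 ≤ ∑ α ∈ B n N, ‖c α‖ ^ 2

lemma star_scalar (a : List (Fin n) → ℂ) (S : Fin n → E →L[ℂ] E)
    (hS : ∀ i j, adjoint (S i) ∘L S j = if i = j then 1 else 0)
    (ξ : E) (hξ : ‖ξ‖ = 1) (hvac : ∀ i, adjoint (S i) ξ = 0) (ha : radiusInv a ≤ 1)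
    (hb : ∀ r : ℝ, 0 ≤ r → r < 1 → ‖∑' k : ℕ, ((r : ℂ) ^ k) • lvlOp a S k‖ ≤ 1) :
    Contr a := by
  intro N c hc
  have hcont : Continuous fun r : ℝ => ∑ β ∈ B n N,
      ‖∑ γ ∈ B n N, (r : ℂ) ^ γ.length * (starRingEnd ℂ (a γ)) * c (γ ++ β)‖ ^ 2 := by
    fun_prop
  have ht := (hcont.tendsto 1).mono_left (nhdsWithin_le_nhds (s := Set.Iio 1))
  simp only [Complex.ofReal_one, one_pow, one_mul] at ht
  refine le_of_tendsto ht ?_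
  have : Set.Ioo (0 : ℝ) 1 ∈ nhdsWithin 1 (Set.Iio 1) := Ioo_mem_nhdsLT zero_lt_one
  filter_upwards [this] with r hr
  exact star_scalar_r a S hS ξ hξ hvac ha r hr.1.le hr.2 (hb r hr.1.le hr.2) N c hc

lemma coef_le (a : List (Fin n) → ℂ) (h : Contr a) (k : ℕ) : lvlCoef a k ≤ 1 := by
  have h1 := h k (fun α => if α.length = k then a α else 0) (fun α hα => if_neg (by omega))
  set s := ∑ α ∈ W n k, ‖a α‖ ^ 2 with hs
  have hs0 : 0 ≤ s := Finset.sum_nonneg fun _ _ => by positivity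
  have h2 : ∑ α ∈ B n k, ‖(if α.length = k then a α else 0)‖ ^ 2 = s := by
    rw [hs]
    symm
    refine Finset.sum_subset_zero_on_sdiff (fun α hα => ?_) (fun α hα => ?_) fun α hα => ?_
    · rw [mem_W] at hα; rw [mem_B]; omega
    · rw [Finset.mem_sdiff, mem_W] at hα; simp [hα.2]
    · rw [mem_W] at hα; simp [hα]
  have h3 : ∑ γ ∈ B n k, (starRingEnd ℂ (a γ)) * (if (γ ++ []).length = k then a (γ ++ []) else 0)
      = (s : ℂ) := by
    rw [hs]
    push_cast
    symm
    refine Finset.sum_subset_zero_on_sdiff (fun α hα => ?_) (fun α hα => ?_) fun α hα => ?_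
    · rw [mem_W] at hα; rw [mem_B]; omega
    · rw [Finset.mem_sdiff, mem_W] at hα; simp [hα.2]
    · rw [mem_W] at hα; simp [hα, Complex.conj_mul']
  have h4 : s ^ 2 ≤ s := by
    rw [h2] at h1
    refine le_trans ?_ h1
    refine le_trans ?_ (Finset.single_le_sum (fun _ _ => by positivity)
      (mem_B.2 (by simp) : ([] : List (Fin n)) ∈ B n k))
    rw [h3]
    simp
  rw [lvlCoef_eq, ← hs]
  refine Real.sqrt_le_iff.2 ⟨zero_le_one, ?_⟩
  by_contra! h5
  nlinarith

lemma star_fin (a : List (Fin n) → ℂ) (h : Contr a) {U : Type*} [NormedAddCommGroup U]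
    [InnerProductSpace ℂ U] [FiniteDimensional ℂ U]
    (N : ℕ) (c : List (Fin n) → U) (hc : ∀ α, N < α.length → c α = 0) :
    ∑ β ∈ B n N, ‖∑ γ ∈ B n N, (starRingEnd ℂ (a γ)) • c (γ ++ β)‖ ^ 2
      ≤ ∑ α ∈ B n N, ‖c α‖ ^ 2 := by
  set b := stdOrthonormalBasis ℂ U
  simp only [← b.sum_sq_norm_inner_right]
  rw [Finset.sum_comm, Finset.sum_comm (s := B n N)]
  refine Finset.sum_le_sum fun i _ => ?_
  simp only [inner_sum, inner_smul_right]
  exact h N (fun α => inner ℂ (b i) (c α)) fun α hα => by simp [hc α hα]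

lemma star_vec (a : List (Fin n) → ℂ) (h : Contr a) {K : Type*} [NormedAddCommGroup K]
    [InnerProductSpace ℂ K]
    (N : ℕ) (c : List (Fin n) → K) (hc : ∀ α, N < α.length → c α = 0) :
    ∑ β ∈ B n N, ‖∑ γ ∈ B n N, (starRingEnd ℂ (a γ)) • c (γ ++ β)‖ ^ 2
      ≤ ∑ α ∈ B n N, ‖c α‖ ^ 2 := by
  classical
  let U : Submodule ℂ K := Submodule.span ℂ ((B n N).image c : Set K)
  have hU : ∀ α, c α ∈ U := by
    intro α
    by_cases hα : α.length ≤ N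
    · exact Submodule.subset_span (by
        rw [Finset.mem_coe]; exact Finset.mem_image_of_mem c (mem_B.2 hα))
    · rw [hc α (by omega)]; exact U.zero_mem
  have : FiniteDimensional ℂ U := FiniteDimensional.span_finset ℂ _
  have := star_fin a h (U := U) N (fun α => ⟨c α, hU α⟩) fun α hα => by
    ext; exact hc α hα
  have hco : ∀ β, ‖∑ γ ∈ B n N, (starRingEnd ℂ (a γ)) • (⟨c (γ ++ β), hU _⟩ : U)‖ =
      ‖∑ γ ∈ B n N, (starRingEnd ℂ (a γ)) • c (γ ++ β)‖ := by
    intro β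
    rw [Submodule.coe_norm, Submodule.coe_sum]
    rfl
  simp only [hco] at this
  exact this

end star

section main
variable {n : ℕ} {K : Type*} [NormedAddCommGroup K] [InnerProductSpace ℂ K] [CompleteSpace K]

lemma exists_defect (X : Fin n → K →L[ℂ] K)
    (h : ∀ x, ∑ i, ‖adjoint (X i) x‖ ^ 2 ≤ ‖x‖ ^ 2) :
    ∃ D : K →L[ℂ] K, ∀ x, ‖D x‖ ^ 2 = ‖x‖ ^ 2 - ∑ i, ‖adjoint (X i) x‖ ^ 2 := by
  have key : ∀ x, RCLike.re (inner ℂ ((1 - ∑ i, X i ∘L adjoint (X i) : K →L[ℂ] K) x) x) =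
      ‖x‖ ^ 2 - ∑ i, ‖adjoint (X i) x‖ ^ 2 := by
    intro x
    rw [_root_.sub_apply, inner_sub_left, map_sub, _root_.one_apply_eq_self,
      ← norm_sq_eq_re_inner, _root_.sum_apply, sum_inner, map_sum]
    congr 1
    refine Finset.sum_congr rfl fun i _ => ?_
    rw [ContinuousLinearMap.comp_apply, ← adjoint_inner_right, ← norm_sq_eq_re_inner]
  have hpos : (0 : K →L[ℂ] K) ≤ 1 - ∑ i, X i ∘L adjoint (X i) := by
    rw [ContinuousLinearMap.nonneg_iff_isPositive, ContinuousLinearMap.isPositive_def']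
    refine ⟨?_, fun x => ?_⟩
    · refine IsSelfAdjoint.sub (IsSelfAdjoint.one _) (isSelfAdjoint_sum _ fun i _ => ?_)
      exact IsSelfAdjoint.mul_star_self (X i)
    · rw [ContinuousLinearMap.reApplyInnerSelf_apply, key]
      linarith [h x]
  obtain ⟨D, hD⟩ := CStarAlgebra.nonneg_iff_eq_star_mul_self.1 hpos
  refine ⟨D, fun x => ?_⟩
  rw [← key, hD, _root_.mul_apply_eq_comp, star_eq_adjoint, adjoint_inner_left,
    ← norm_sq_eq_re_inner]

lemma sum_defect (X : Fin n → K →L[ℂ] K) (D : K →L[ℂ] K)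
    (hD : ∀ x, ‖D x‖ ^ 2 = ‖x‖ ^ 2 - ∑ i, ‖adjoint (X i) x‖ ^ 2) (k : ℕ) (x : K) :
    ∑ α ∈ W n k, ‖D (adjoint (wordProd X α) x)‖ ^ 2 = Q X k x - Q X (k + 1) x := by
  simp only [hD, Finset.sum_sub_distrib, Q_succ]; rfl

lemma main_bound (a : List (Fin n) → ℂ) (h : Contr a) (X : Fin n → K →L[ℂ] K) {ρ : ℝ}
    (hρ : 0 ≤ ρ) (hρ1 : ρ < 1)
    (hX : ∀ x, ∑ i, ‖adjoint (X i) x‖ ^ 2 ≤ ρ ^ 2 * ‖x‖ ^ 2)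
    (m : ℕ) (hvanish : ∀ β : List (Fin n), β.length < m → a β = 0)
    (hsum : Summable fun k => lvlOp a X k) (x : K) :
    ‖adjoint (∑' k, lvlOp a X k) x‖ ^ 2 ≤ Q X m x := by
  obtain ⟨D, hD⟩ := exists_defect X fun x => (hX x).trans (by
    have : ρ ^ 2 ≤ 1 := pow_le_one₀ hρ hρ1.le
    exact mul_le_of_le_one_left (by positivity) this)
  set F := ∑' k, lvlOp a X k with hF
  have step1 : ∀ N M : ℕ, M ≤ N → ∑ β ∈ B n M, ‖D (adjoint (wordProd X β)
      (∑ k ∈ Finset.range (N + 1 - β.length), adjoint (lvlOp a X k) x))‖ ^ 2 ≤ Q X m x := by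
    intro N M hMN
    have h1 := star_vec a h N (fun α => if m ≤ α.length ∧ α.length ≤ N then
      D (adjoint (wordProd X α) x) else 0) fun α hα => if_neg (by omega)
    have h2 : ∑ α ∈ B n N, ‖(if m ≤ α.length ∧ α.length ≤ N then
        D (adjoint (wordProd X α) x) else 0)‖ ^ 2 ≤ Q X m x := by
      have h3 : ∑ α ∈ B n N, ‖(if m ≤ α.length ∧ α.length ≤ N then
        D (adjoint (wordProd X α) x) else 0)‖ ^ 2 = ∑ k ∈ Finset.range (N + 1),
          if m ≤ k then Q X k x - Q X (k + 1) x else 0 := by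
        rw [sum_B]
        refine Finset.sum_congr rfl fun k hk => ?_
        rw [Finset.mem_range] at hk
        by_cases hmk : m ≤ k
        · rw [if_pos hmk, ← sum_defect X D hD]
          refine Finset.sum_congr rfl fun α hα => ?_
          rw [mem_W] at hα
          rw [if_pos (by omega)]
        · rw [if_neg hmk]
          refine Finset.sum_eq_zero fun α hα => ?_
          rw [mem_W] at hα
          rw [if_neg (by omega)]; simp
      have h4 : ∀ N, (∑ k ∈ Finset.range N, if m ≤ k then Q X k x - Q X (k + 1) x else 0) =
          if m ≤ N then Q X m x - Q X N x else 0 := by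
        intro N
        induction N with
        | zero => by_cases hm : m = 0 <;> simp [hm]
        | succ N ih =>
          rw [Finset.sum_range_succ, ih]
          by_cases h5 : m ≤ N
          · simp [h5, Nat.le_succ_of_le h5]
          · by_cases h6 : m = N + 1
            · subst h6; simp
            · have : ¬ m ≤ N + 1 := by omega
              simp [h5, this]
      rw [h3, h4]
      have := Q_nonneg X m x
      have := Q_nonneg X (N + 1) x
      split_ifs <;> linarith
    refine le_trans ?_ (h1.trans h2)
    refine le_trans (le_of_eq ?_) (Finset.sum_le_sum_of_subset_of_nonneg
      (fun α hα => mem_B.2 ((mem_B.1 hα).trans hMN)) fun _ _ _ => by positivity)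
    refine Finset.sum_congr rfl fun β hβ => ?_
    rw [mem_B] at hβ
    congr 2
    rw [sum_B, map_sum, map_sum]
    refine Finset.sum_subset_zero_on_sdiff (fun k hk => ?_) (fun k hk => ?_) fun k hk => ?_
    · simp at hk ⊢; omega
    · simp at hk
      refine Finset.sum_eq_zero fun γ hγ => ?_
      rw [mem_W] at hγ
      rw [if_neg, smul_zero]
      simp only [List.length_append]; omega
    · simp at hk
      rw [lvlOp_eq, map_sum, _root_.sum_apply, map_sum, map_sum]
      refine Finset.sum_congr rfl fun γ hγ => ?_
      rw [mem_W] at hγ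
      by_cases hm : m ≤ k
      · rw [if_pos (by simp; omega), adj_append, adj_smul, map_smul, map_smul]
      · rw [hvanish γ (by omega)]; simp
  have step2 : ∀ M : ℕ, ∑ β ∈ B n M, ‖D (adjoint (wordProd X β) (adjoint F x))‖ ^ 2 ≤ Q X m x := by
    intro M
    have ht : Tendsto (fun N : ℕ => ∑ k ∈ Finset.range N, adjoint (lvlOp a X k) x) atTop
        (nhds (adjoint F x)) := by
      have h1 := hsum.hasSum.tendsto_sum_nat
      have h2 : Continuous fun T : K →L[ℂ] K => adjoint T x := by
        have := (adjoint : (K →L[ℂ] K) ≃ₗᵢ⋆[ℂ] (K →L[ℂ] K)).continuous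
        fun_prop
      have h3 := (h2.tendsto F).comp h1
      refine h3.congr fun N => ?_
      simp [map_sum, _root_.sum_apply]
    refine le_of_tendsto (f := fun N : ℕ => ∑ β ∈ B n M, ‖D (adjoint (wordProd X β)
      (∑ k ∈ Finset.range (N + 1 - β.length), adjoint (lvlOp a X k) x))‖ ^ 2) (x := atTop) ?_ ?_
    · refine tendsto_finsetSum _ fun β _ => ?_
      have h4 : Tendsto (fun N : ℕ => N + 1 - β.length) atTop atTop :=
        (tendsto_sub_atTop_nat β.length).comp (tendsto_add_atTop_nat 1)
      have h5 : Continuous fun y : K => ‖D (adjoint (wordProd X β) y)‖ ^ 2 := by fun_prop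
      exact (h5.tendsto _).comp (ht.comp h4)
    · filter_upwards [eventually_ge_atTop M] with N hN using step1 N M hN
  have step3 : ∀ M : ℕ, ‖adjoint F x‖ ^ 2 - (ρ ^ (M + 1)) ^ 2 * ‖adjoint F x‖ ^ 2 ≤ Q X m x := by
    intro M
    refine le_trans ?_ (step2 M)
    rw [sum_B]
    simp only [sum_defect X D hD]
    rw [Finset.sum_range_sub', Q_zero]
    linarith [Q_le X hX (M + 1) (adjoint F x)]
  have hlim : Tendsto (fun M : ℕ => ‖adjoint F x‖ ^ 2 - (ρ ^ (M + 1)) ^ 2 * ‖adjoint F x‖ ^ 2)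
      atTop (nhds (‖adjoint F x‖ ^ 2 - 0 ^ 2 * ‖adjoint F x‖ ^ 2)) := by
    have := (tendsto_pow_atTop_nhds_zero_of_lt_one hρ hρ1).comp (tendsto_add_atTop_nat 1)
    exact tendsto_const_nhds.sub ((this.pow 2).mul_const _)
  have := le_of_tendsto' hlim step3
  simpa using this

end main

end Schw

/-- **Schwartz-type lemma for free holomorphic functions.** Suppose
(a) `limsup_k (∑_{|α|=k}|a_α|²)^{1/(2k)} ≤ 1`, (b) `a_β = 0` for `|β| ≤ m−1`, and
(c) `‖f(rS)‖ ≤ 1` for all `r ∈ [0,1)` (where `S` are isometries with pairwise orthogonal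
ranges and vacuum vector `ξ`). Then for every `n`-tuple `X` with `‖X‖_row < 1` the series
`f(X)` converges absolutely and
`‖f(X)‖ ≤ ‖∑_{|β|=m} X_β X_β^*‖^{1/2} ≤ (‖X‖_row)^m`; moreover
`(∑_{|α|=k}|a_α|²)^{1/2} ≤ 1` for every `k ≥ m`. -/
theorem stmt_12 {n : ℕ} (hn : 0 < n) (a : List (Fin n) → ℂ)
    {E : Type*} [NormedAddCommGroup E] [InnerProductSpace ℂ E] [CompleteSpace E]
    (S : Fin n → E →L[ℂ] E)
    (hS : ∀ i j, ContinuousLinearMap.adjoint (S i) ∘L S j = if i = j then 1 else 0)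
    (ξ : E) (hξ : ‖ξ‖ = 1) (hvac : ∀ i, ContinuousLinearMap.adjoint (S i) ξ = 0)
    (m : ℕ) (hm : 1 ≤ m)
    (ha : radiusInv a ≤ 1)
    (hvanish : ∀ β : List (Fin n), β.length < m → a β = 0)
    (hbound : ∀ r : ℝ, 0 ≤ r → r < 1 →
      ‖∑' k : ℕ, ((r : ℂ) ^ k) • lvlOp a S k‖ ≤ 1)
    {K : Type*} [NormedAddCommGroup K] [InnerProductSpace ℂ K] [CompleteSpace K]
    (X : Fin n → K →L[ℂ] K) (hX : rowNorm X < 1) :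
    (Summable (fun k : ℕ => ‖lvlOp a X k‖) ∧
      ‖∑' k : ℕ, lvlOp a X k‖ ≤
        Real.sqrt ‖∑ w : Fin m → Fin n, wordProd X (List.ofFn w) ∘L
          ContinuousLinearMap.adjoint (wordProd X (List.ofFn w))‖ ∧
      Real.sqrt ‖∑ w : Fin m → Fin n, wordProd X (List.ofFn w) ∘L
          ContinuousLinearMap.adjoint (wordProd X (List.ofFn w))‖ ≤ rowNorm X ^ m) ∧
    (∀ k : ℕ, m ≤ k → lvlCoef a k ≤ 1) := by
  have hrow : ∀ x, ∑ i, ‖ContinuousLinearMap.adjoint (X i) x‖ ^ 2 ≤ rowNorm X ^ 2 * ‖x‖ ^ 2 := by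
    intro x
    rw [rowNorm, Real.sq_sqrt (norm_nonneg _)]
    exact Schw.sum_le_norm _ X x
  have hρ : 0 ≤ rowNorm X := Real.sqrt_nonneg _
  have hC := Schw.star_scalar a S hS ξ hξ hvac ha hbound
  have hsum : Summable (fun k : ℕ => ‖lvlOp a X k‖) :=
    Summable.of_nonneg_of_le (fun _ => norm_nonneg _) (Schw.lvlOp_norm_le a X hρ hrow)
      (Schw.summable_coef a ha hρ hX)
  refine ⟨⟨hsum, ?_, ?_⟩, fun k _ => Schw.coef_le a hC k⟩
  · rw [← (ContinuousLinearMap.adjoint : (K →L[ℂ] K) ≃ₗᵢ⋆[ℂ] (K →L[ℂ] K)).norm_map]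
    refine ContinuousLinearMap.opNorm_le_bound _ (Real.sqrt_nonneg _) fun x => ?_
    have h1 := Schw.main_bound a hC X hρ hX hrow m hvanish hsum.of_norm x
    have h2 := Schw.sum_le_norm Finset.univ
      (fun w : Fin m → Fin n => wordProd X (List.ofFn w)) x
    rw [Schw.Q, Schw.sum_W] at h1
    refine le_of_sq_le_sq ?_ (by positivity)
    rw [mul_pow, Real.sq_sqrt (norm_nonneg _)]
    exact h1.trans h2
  · refine Real.sqrt_le_iff.2 ⟨by positivity, ?_⟩
    refine Schw.norm_sum_le _ (fun w : Fin m → Fin n => wordProd X (List.ofFn w))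
      (by positivity) fun x => ?_
    have := Schw.Q_le X hrow m x
    rwa [Schw.Q, Schw.sum_W] at this
end

section
/- Maximum principle / von Neumann-type inequality on row-balls: Let S_1,…,S_n be isometries with pairwise orthogonal ranges and vacuum vector ξ on a complex Hilbert space E, and let a : F_n^+ → ℂ satisfy limsup_{k→∞}(∑_{|α|=k}|a_α|²)^{1/(2k)} ≤ 1. Then for every r ∈ [0,1), every complex Hilbert space K, and every n-tuple X of bounded operators on K with ‖X‖_row ≤ r, the series f(X) := ∑_{k=0}^∞ ∑_{|α|=k} a_α X_α and f(rS) := ∑_{k=0}^∞ r^k ∑_{|α|=k} a_α S_α converge in operator norm and ‖f(X)‖ ≤ ‖f(rS)‖. In particular the maximum of ‖f(X)‖ over all tuples with ‖X‖_row ≤ r is attained at the tuple (rS_1,…,rS_n), whose row norm equals r. -/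
open Filter MeasureTheory
open scoped ENNReal

variable {n : ℕ}

/-- words of length k -/
def wds (n k : ℕ) : Finset (List (Fin n)) := Finset.univ.image (fun w : Fin k → Fin n => List.ofFn w)

theorem sum_ofFn {M : Type*} [AddCommMonoid M] (k : ℕ) (F : List (Fin n) → M) :
    ∑ w : Fin k → Fin n, F (List.ofFn w) = ∑ α ∈ wds n k, F α := by
  unfold wds
  rw [Finset.sum_image]
  intro x _ y _ h
  exact List.ofFn_injective h

theorem mem_wds {k : ℕ} {α : List (Fin n)} : α ∈ wds n k ↔ α.length = k := by
  unfold wds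
  constructor
  · intro h
    simp only [Finset.mem_image] at h
    obtain ⟨w, _, rfl⟩ := h
    simp
  · rintro rfl
    simp only [Finset.mem_image]
    exact ⟨α.get, Finset.mem_univ _, List.ofFn_get α⟩

theorem sum_wds_succ {M : Type*} [AddCommMonoid M] (k : ℕ) (F : List (Fin n) → M) :
    ∑ α ∈ wds n (k+1), F α = ∑ α ∈ wds n k, ∑ i : Fin n, F (α ++ [i]) := by
  rw [← sum_ofFn, ← sum_ofFn k (fun α => ∑ i : Fin n, F (α ++ [i]))]
  rw [← Equiv.sum_comp (Fin.snocEquiv (fun _ : Fin (k+1) => Fin n)), Fintype.sum_prod_type_right]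
  refine Finset.sum_congr rfl fun w _ => Finset.sum_congr rfl fun i _ => ?_
  congr 1
  change List.ofFn (Fin.snoc (α := fun _ => Fin n) w i) = _
  rw [List.ofFn_succ']
  simp [-List.ofFn_succ]

/-- words of length less than k -/
def wlt (n N : ℕ) : Finset (List (Fin n)) := (Finset.range N).biUnion (wds n)

theorem mem_wlt {N : ℕ} {α : List (Fin n)} : α ∈ wlt n N ↔ α.length < N := by
  simp [wlt, mem_wds]

theorem sum_wlt {M : Type*} [AddCommMonoid M] (N : ℕ) (F : List (Fin n) → M) :
    ∑ α ∈ wlt n N, F α = ∑ k ∈ Finset.range N, ∑ α ∈ wds n k, F α := by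
  unfold wlt
  rw [Finset.sum_biUnion]
  intro i _ j _ hij
  rw [Function.onFun, Finset.disjoint_left]
  intro α h1 h2
  rw [mem_wds] at h1 h2
  exact hij (h1.symm.trans h2)

theorem wordProd_append {H : Type*} [NormedAddCommGroup H] [NormedSpace ℂ H]
    (X : Fin n → H →L[ℂ] H) (α β : List (Fin n)) :
    wordProd X (α ++ β) = wordProd X α * wordProd X β := by
  simp [wordProd]

theorem exists_coords {H : Type*} [NormedAddCommGroup H] [InnerProductSpace ℂ H]
    (s : Finset H) : ∃ (d : ℕ) (b : Fin d → H), ∀ x ∈ Submodule.span ℂ (s : Set H),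
      ‖x‖ ^ 2 = ∑ j, ‖inner ℂ (b j) x‖ ^ 2 := by
  let V := Submodule.span ℂ (s : Set H)
  have : FiniteDimensional ℂ V := FiniteDimensional.span_finset ℂ s
  let b := stdOrthonormalBasis ℂ V
  refine ⟨_, fun j => (b j : H), fun x hx => ?_⟩
  have := b.sum_sq_norm_inner_right ⟨x, hx⟩
  simpa using this.symm

section fock
variable {E : Type*} [NormedAddCommGroup E] [InnerProductSpace ℂ E] [CompleteSpace E]
    (S : Fin n → E →L[ℂ] E)
    (hS : ∀ i j, ContinuousLinearMap.adjoint (S i) ∘L S j = if i = j then 1 else 0)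
    (ξ : E) (hξ : ‖ξ‖ = 1) (hvac : ∀ i, ContinuousLinearMap.adjoint (S i) ξ = 0)

theorem inner_S (hS : ∀ i j, ContinuousLinearMap.adjoint (S i) ∘L S j = if i = j then 1 else 0)
    (i j : Fin n) (x y : E) :
    inner ℂ (S i x) (S j y) = if i = j then inner ℂ x y else 0 := by
  rw [← ContinuousLinearMap.adjoint_inner_right]
  have := congrArg (fun T : E →L[ℂ] E => T y) (hS i j)
  simp only [ContinuousLinearMap.comp_apply] at this
  rw [this]
  split_ifs <;> simp

theorem orth_words (hS : ∀ i j, ContinuousLinearMap.adjoint (S i) ∘L S j = if i = j then 1 else 0)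
    (hξ : ‖ξ‖ = 1) (hvac : ∀ i, ContinuousLinearMap.adjoint (S i) ξ = 0) :
    Orthonormal ℂ (fun α : List (Fin n) => wordProd S α ξ) := by
  rw [orthonormal_iff_ite]
  intro α
  induction α with
  | nil =>
    intro β
    cases β with
    | nil => simp [wordProd, hξ]
    | cons j β =>
      simp [wordProd, ← ContinuousLinearMap.adjoint_inner_left, hvac]
  | cons i α ih =>
    intro β
    cases β with
    | nil => simp [wordProd, ← ContinuousLinearMap.adjoint_inner_right, hvac]
    | cons j β =>
      have h := ih β
      simp only [wordProd] at h
      simp only [wordProd, List.map_cons, List.prod_cons]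
      change inner ℂ (S i ((List.map S α).prod ξ)) (S j ((List.map S β).prod ξ)) = _
      rw [inner_S S hS, h]
      by_cases h1 : i = j <;> by_cases h2 : α = β <;> simp [h1, h2]

theorem scalar_ineq
    (hS : ∀ i j, ContinuousLinearMap.adjoint (S i) ∘L S j = if i = j then 1 else 0)
    (hξ : ‖ξ‖ = 1) (hvac : ∀ i, ContinuousLinearMap.adjoint (S i) ξ = 0)
    (c : List (Fin n) → ℂ) (N m : ℕ) (z : List (Fin n) → ℂ) :
    ∑ β ∈ wlt n m, ‖∑ α ∈ wlt n N, star (c α) * z (α ++ β)‖ ^ 2 ≤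
      ‖∑ α ∈ wlt n N, c α • wordProd S α‖ ^ 2 * ∑ γ ∈ wlt n (m + N), ‖z γ‖ ^ 2 := by
  classical
  set P := ∑ α ∈ wlt n N, c α • wordProd S α with hP
  have ho := orth_words S ξ hS hξ hvac
  set v : E := ∑ γ ∈ wlt n (m + N), z γ • wordProd S γ ξ with hv
  have hin : ∀ γ ∈ wlt n (m+N), inner ℂ (wordProd S γ ξ) v = z γ := fun γ hγ =>
    ho.inner_right_sum z hγ
  have hvn : ‖v‖ ^ 2 = ∑ γ ∈ wlt n (m + N), ‖z γ‖ ^ 2 := by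
    have h1 : inner ℂ v v = ∑ γ ∈ wlt n (m + N), (starRingEnd ℂ) (z γ) * z γ :=
      ho.inner_sum z z _
    rw [inner_self_eq_norm_sq_to_K] at h1
    have h2 : ((‖v‖ ^ 2 : ℝ) : ℂ) = ((∑ γ ∈ wlt n (m + N), ‖z γ‖ ^ 2 : ℝ) : ℂ) := by
      push_cast
      simp only [Complex.conj_mul'] at h1
      exact h1
    exact_mod_cast h2
  have hb := ho.sum_inner_products_le (s := wlt n m) (ContinuousLinearMap.adjoint P v)
  have he : ∀ β ∈ wlt n m, inner ℂ (wordProd S β ξ) (ContinuousLinearMap.adjoint P v)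
      = ∑ α ∈ wlt n N, star (c α) * z (α ++ β) := by
    intro β hβ
    rw [ContinuousLinearMap.adjoint_inner_right, hP]
    simp only [_root_.sum_apply, sum_inner, _root_.smul_apply,
      inner_smul_left]
    refine Finset.sum_congr rfl fun α hα => ?_
    rw [← hin (α ++ β), wordProd_append]
    · rfl
    · rw [mem_wlt] at *
      rw [List.length_append]; omega
  rw [Finset.sum_congr rfl (fun β hβ => by rw [← he β hβ])]
  refine hb.trans ?_
  rw [← hvn, ← mul_pow]
  gcongr
  refine (ContinuousLinearMap.le_opNorm _ _).trans ?_
  rw [LinearIsometryEquiv.norm_map]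

theorem vec_ineq
    (hS : ∀ i j, ContinuousLinearMap.adjoint (S i) ∘L S j = if i = j then 1 else 0)
    (hξ : ‖ξ‖ = 1) (hvac : ∀ i, ContinuousLinearMap.adjoint (S i) ξ = 0)
    {K : Type*} [NormedAddCommGroup K] [InnerProductSpace ℂ K]
    (c : List (Fin n) → ℂ) (N m : ℕ) (u : List (Fin n) → K) :
    ∑ β ∈ wlt n m, ‖∑ α ∈ wlt n N, star (c α) • u (α ++ β)‖ ^ 2 ≤
      ‖∑ α ∈ wlt n N, c α • wordProd S α‖ ^ 2 * ∑ γ ∈ wlt n (m + N), ‖u γ‖ ^ 2 := by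
  classical
  obtain ⟨d, b, hb⟩ := exists_coords ((wlt n (m+N)).image u)
  have hmem : ∀ γ ∈ wlt n (m+N), u γ ∈ Submodule.span ℂ (((wlt n (m+N)).image u : Finset K) : Set K) :=
    fun γ hγ => Submodule.subset_span (Finset.mem_coe.2 (Finset.mem_image_of_mem u hγ))
  have h1 : ∀ β ∈ wlt n m, ‖∑ α ∈ wlt n N, star (c α) • u (α ++ β)‖ ^ 2
      = ∑ j, ‖∑ α ∈ wlt n N, star (c α) * inner ℂ (b j) (u (α ++ β))‖ ^ 2 := by
    intro β hβ
    rw [hb]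
    · simp only [inner_sum, inner_smul_right]
    · refine Submodule.sum_mem _ fun α hα => Submodule.smul_mem _ _ (hmem _ ?_)
      rw [mem_wlt] at *
      rw [List.length_append]; omega
  have h2 : ∑ γ ∈ wlt n (m + N), ‖u γ‖ ^ 2
      = ∑ j, ∑ γ ∈ wlt n (m + N), ‖inner ℂ (b j) (u γ)‖ ^ 2 := by
    rw [Finset.sum_comm]
    exact Finset.sum_congr rfl (fun γ hγ => hb _ (hmem γ hγ))
  have h3 := Finset.sum_le_sum (s := Finset.univ) fun j _ =>
    scalar_ineq S ξ hS hξ hvac c N m (fun γ => inner ℂ (b j) (u γ))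
  rw [Finset.sum_congr rfl h1, h2, Finset.sum_comm, Finset.mul_sum]
  exact h3
end fock

section row
variable {K : Type*} [NormedAddCommGroup K] [InnerProductSpace ℂ K] [CompleteSpace K]

theorem adj_smul (z : ℂ) (T : K →L[ℂ] K) (h : K) :
    ContinuousLinearMap.adjoint (z • T) h = star z • ContinuousLinearMap.adjoint T h := by
  have : ContinuousLinearMap.adjoint (z • T) = star z • ContinuousLinearMap.adjoint T :=
    LinearIsometryEquiv.map_smulₛₗ _ _ _
  rw [this]
  rfl

theorem inner_row (X : Fin n → K →L[ℂ] K) (h : K) :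
    inner ℂ ((∑ i, X i ∘L ContinuousLinearMap.adjoint (X i)) h) h =
      ((∑ i, ‖ContinuousLinearMap.adjoint (X i) h‖ ^ 2 : ℝ) : ℂ) := by
  rw [_root_.sum_apply, sum_inner]
  push_cast
  refine Finset.sum_congr rfl fun i _ => ?_
  change inner ℂ (X i (ContinuousLinearMap.adjoint (X i) h)) h = _
  rw [← ContinuousLinearMap.adjoint_inner_right,
    inner_self_eq_norm_sq_to_K]
  rfl

theorem row_bound (X : Fin n → K →L[ℂ] K) (r : ℝ) (hX : rowNorm X ≤ r) (h : K) :
    ∑ i, ‖ContinuousLinearMap.adjoint (X i) h‖ ^ 2 ≤ r ^ 2 * ‖h‖ ^ 2 := by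
  have h0 : 0 ≤ r := (Real.sqrt_nonneg _).trans hX
  have h1 : ‖∑ i, X i ∘L ContinuousLinearMap.adjoint (X i)‖ ≤ r ^ 2 :=
    (Real.sqrt_le_left h0).1 hX
  have h2 := norm_inner_le_norm (𝕜 := ℂ) ((∑ i, X i ∘L ContinuousLinearMap.adjoint (X i)) h) h
  rw [inner_row, Complex.norm_real, Real.norm_eq_abs] at h2
  refine (le_abs_self _).trans (h2.trans ?_)
  have h3 := ContinuousLinearMap.le_opNorm (∑ i, X i ∘L ContinuousLinearMap.adjoint (X i)) h
  calc _ ≤ (‖∑ i, X i ∘L ContinuousLinearMap.adjoint (X i)‖ * ‖h‖) * ‖h‖ := by gcongr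
    _ ≤ (r ^ 2 * ‖h‖) * ‖h‖ := by gcongr
    _ = _ := by ring

theorem adj_append (X : Fin n → K →L[ℂ] K) (α β : List (Fin n)) (h : K) :
    ContinuousLinearMap.adjoint (wordProd X (α ++ β)) h =
    ContinuousLinearMap.adjoint (wordProd X β) (ContinuousLinearMap.adjoint (wordProd X α) h) := by
  rw [wordProd_append]
  have := ContinuousLinearMap.adjoint_comp (wordProd X α) (wordProd X β)
  exact congrArg (fun T : K →L[ℂ] K => T h) this

theorem lvl_bound (X : Fin n → K →L[ℂ] K) (r : ℝ)
    (hX : ∀ h, ∑ i, ‖ContinuousLinearMap.adjoint (X i) h‖ ^ 2 ≤ r ^ 2 * ‖h‖ ^ 2) (k : ℕ) (h : K) :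
    ∑ α ∈ wds n k, ‖ContinuousLinearMap.adjoint (wordProd X α) h‖ ^ 2 ≤ (r ^ 2) ^ k * ‖h‖ ^ 2 := by
  induction k with
  | zero =>
    rw [← sum_ofFn]
    simp [wordProd, ← ContinuousLinearMap.star_eq_adjoint]
  | succ k ih =>
    rw [sum_wds_succ]
    calc _ ≤ ∑ α ∈ wds n k, r ^ 2 * ‖ContinuousLinearMap.adjoint (wordProd X α) h‖ ^ 2 := by
          refine Finset.sum_le_sum fun α _ => ?_
          have := hX (ContinuousLinearMap.adjoint (wordProd X α) h)
          refine le_trans (le_of_eq ?_) this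
          refine Finset.sum_congr rfl fun i _ => ?_
          rw [adj_append]
          simp [wordProd]
      _ ≤ r ^ 2 * ((r ^ 2) ^ k * ‖h‖ ^ 2) := by
          rw [← Finset.mul_sum]; gcongr
      _ = _ := by ring

theorem exists_defect (Y : Fin n → K →L[ℂ] K)
    (hY : ∀ h, ∑ i, ‖ContinuousLinearMap.adjoint (Y i) h‖ ^ 2 ≤ ‖h‖ ^ 2) :
    ∃ B : K →L[ℂ] K, ∀ h, ‖B h‖ ^ 2 = ‖h‖ ^ 2 - ∑ i, ‖ContinuousLinearMap.adjoint (Y i) h‖ ^ 2 := by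
  set Q : K →L[ℂ] K := 1 - ∑ i, Y i ∘L ContinuousLinearMap.adjoint (Y i) with hQ
  have key : ∀ h, inner ℂ (Q h) h =
      ((‖h‖ ^ 2 - ∑ i, ‖ContinuousLinearMap.adjoint (Y i) h‖ ^ 2 : ℝ) : ℂ) := by
    intro h
    rw [hQ, _root_.sub_apply, inner_sub_left, inner_row, one_apply_eq_self,
      inner_self_eq_norm_sq_to_K]
    push_cast
    rfl
  have hpos : 0 ≤ Q := by
    rw [ContinuousLinearMap.nonneg_iff_isPositive, ContinuousLinearMap.isPositive_iff_complex]
    intro x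
    rw [key]
    refine ⟨?_, ?_⟩
    · rfl
    · have := hY x
      simp only [RCLike.re_to_complex, Complex.ofReal_re]
      linarith
  obtain ⟨B, hB⟩ := CStarAlgebra.nonneg_iff_eq_star_mul_self.1 hpos
  refine ⟨B, fun h => ?_⟩
  have h1 := key h
  rw [hB] at h1
  have h2 : inner ℂ ((star B * B) h) h = ((‖B h‖ ^ 2 : ℝ) : ℂ) := by
    change inner ℂ (ContinuousLinearMap.adjoint B (B h)) h = _
    rw [ContinuousLinearMap.adjoint_inner_left, inner_self_eq_norm_sq_to_K]
    push_cast
    rfl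
  rw [h2] at h1
  exact_mod_cast h1

theorem telescope (Y : Fin n → K →L[ℂ] K) (B : K →L[ℂ] K)
    (hB : ∀ h, ‖B h‖ ^ 2 = ‖h‖ ^ 2 - ∑ i, ‖ContinuousLinearMap.adjoint (Y i) h‖ ^ 2) (m : ℕ) (h : K) :
    ∑ α ∈ wlt n m, ‖B (ContinuousLinearMap.adjoint (wordProd Y α) h)‖ ^ 2 =
      ‖h‖ ^ 2 - ∑ α ∈ wds n m, ‖ContinuousLinearMap.adjoint (wordProd Y α) h‖ ^ 2 := by
  rw [sum_wlt]
  induction m with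
  | zero =>
    rw [← sum_ofFn]
    simp [wordProd, ← ContinuousLinearMap.star_eq_adjoint]
  | succ m ih =>
    rw [Finset.sum_range_succ, ih, sum_wds_succ]
    simp only [hB, Finset.sum_sub_distrib, adj_append]
    simp [wordProd]

theorem poly_ineq {E : Type*} [NormedAddCommGroup E] [InnerProductSpace ℂ E] [CompleteSpace E]
    (S : Fin n → E →L[ℂ] E) (ξ : E)
    (hS : ∀ i j, ContinuousLinearMap.adjoint (S i) ∘L S j = if i = j then 1 else 0)
    (hξ : ‖ξ‖ = 1) (hvac : ∀ i, ContinuousLinearMap.adjoint (S i) ξ = 0)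
    (Y : Fin n → K →L[ℂ] K) (t : ℝ) (ht0 : 0 ≤ t) (ht1 : t < 1)
    (hY : ∀ h, ∑ i, ‖ContinuousLinearMap.adjoint (Y i) h‖ ^ 2 ≤ t ^ 2 * ‖h‖ ^ 2)
    (c : List (Fin n) → ℂ) (N : ℕ) :
    ‖∑ α ∈ wlt n N, c α • wordProd Y α‖ ≤ ‖∑ α ∈ wlt n N, c α • wordProd S α‖ := by
  set M := ‖∑ α ∈ wlt n N, c α • wordProd S α‖ with hM
  set p := ∑ α ∈ wlt n N, c α • wordProd Y α with hp
  have ht2 : t ^ 2 < 1 := by nlinarith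
  obtain ⟨B, hB⟩ := exists_defect Y (fun h => (hY h).trans (by nlinarith [sq_nonneg ‖h‖]))
  rw [← LinearIsometryEquiv.norm_map ContinuousLinearMap.adjoint p]
  have hpa : ∀ h, ContinuousLinearMap.adjoint p h =
      ∑ α ∈ wlt n N, star (c α) • ContinuousLinearMap.adjoint (wordProd Y α) h := by
    intro h
    rw [hp, map_sum, _root_.sum_apply]
    exact Finset.sum_congr rfl fun α _ => adj_smul _ _ _
  refine ContinuousLinearMap.opNorm_le_bound _ (norm_nonneg _) fun h => ?_
  refine abs_le_of_sq_le_sq' ?_ (by positivity) |>.2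
  rw [mul_pow]
  set q := ContinuousLinearMap.adjoint p h with hq
  have main : ∀ m : ℕ, (1 - (t ^ 2) ^ m) * ‖q‖ ^ 2 ≤ M ^ 2 * ‖h‖ ^ 2 := by
    intro m
    have h1 := vec_ineq S ξ hS hξ hvac c N m
      (fun γ => B (ContinuousLinearMap.adjoint (wordProd Y γ) h))
    have h2 : ∀ β ∈ wlt n m, ‖∑ α ∈ wlt n N, star (c α) •
        B (ContinuousLinearMap.adjoint (wordProd Y (α ++ β)) h)‖ ^ 2
        = ‖B (ContinuousLinearMap.adjoint (wordProd Y β) q)‖ ^ 2 := by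
      intro β _
      rw [hq, hpa h]
      simp only [map_sum, map_smul, adj_append]
    rw [Finset.sum_congr rfl h2, telescope Y B hB, telescope Y B hB] at h1
    have h3 := lvl_bound Y t hY m q
    have h4 : 0 ≤ ∑ α ∈ wds n (m+N), ‖ContinuousLinearMap.adjoint (wordProd Y α) h‖ ^ 2 :=
      Finset.sum_nonneg fun _ _ => by positivity
    have h5 := mul_nonneg (sq_nonneg M) h4
    nlinarith
  have hlim : Tendsto (fun m : ℕ => (1 - (t ^ 2) ^ m) * ‖q‖ ^ 2) atTop (nhds ((1 - 0) * ‖q‖ ^ 2)) :=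
    ((tendsto_pow_atTop_nhds_zero_of_lt_one (sq_nonneg t) ht2).const_sub 1).mul_const _
  have := le_of_tendsto' hlim main
  simpa using this

theorem lvlOp_norm (X : Fin n → K →L[ℂ] K) (r : ℝ) (hr : 0 ≤ r)
    (hX : ∀ h, ∑ i, ‖ContinuousLinearMap.adjoint (X i) h‖ ^ 2 ≤ r ^ 2 * ‖h‖ ^ 2)
    (a : List (Fin n) → ℂ) (k : ℕ) : ‖lvlOp a X k‖ ≤ lvlCoef a k * r ^ k := by
  unfold lvlOp lvlCoef
  rw [sum_ofFn k (fun α => a α • wordProd X α), sum_ofFn k (fun α => ‖a α‖ ^ 2)]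
  rw [← LinearIsometryEquiv.norm_map ContinuousLinearMap.adjoint]
  refine ContinuousLinearMap.opNorm_le_bound _ (by positivity) fun h => ?_
  have hpa : ContinuousLinearMap.adjoint (∑ α ∈ wds n k, a α • wordProd X α) h =
      ∑ α ∈ wds n k, star (a α) • ContinuousLinearMap.adjoint (wordProd X α) h := by
    rw [map_sum, _root_.sum_apply]
    exact Finset.sum_congr rfl fun α _ => adj_smul _ _ _
  rw [hpa]
  calc _ ≤ ∑ α ∈ wds n k, ‖a α‖ * ‖ContinuousLinearMap.adjoint (wordProd X α) h‖ := by
        refine (norm_sum_le _ _).trans (le_of_eq ?_)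
        simp [norm_smul]
    _ ≤ Real.sqrt (∑ α ∈ wds n k, ‖a α‖ ^ 2) *
        Real.sqrt (∑ α ∈ wds n k, ‖ContinuousLinearMap.adjoint (wordProd X α) h‖ ^ 2) :=
        Real.sum_mul_le_sqrt_mul_sqrt _ _ _
    _ ≤ Real.sqrt (∑ α ∈ wds n k, ‖a α‖ ^ 2) * (r ^ k * ‖h‖) := by
        gcongr
        rw [Real.sqrt_le_left (by positivity)]
        refine (lvl_bound X r hX k h).trans (le_of_eq ?_)
        ring
    _ = _ := by ring
end row

theorem coef_summable (a : List (Fin n) → ℂ) (ha : radiusInv a ≤ 1) (r : ℝ) (hr0 : 0 ≤ r)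
    (hr1 : r < 1) : Summable (fun k => lvlCoef a k * r ^ k) := by
  set Q : ℝ := 2 / (1 + r) with hQ
  have hQ1 : 1 < Q := by rw [hQ, lt_div_iff₀ (by linarith)]; linarith
  have hQr : Q * r < 1 := by
    rw [hQ, div_mul_eq_mul_div, div_lt_one (by linarith)]; linarith
  have hs1 : 1 < Real.sqrt Q := by
    rw [Real.lt_sqrt (by norm_num)]; simpa using hQ1
  have hlt : radiusInv a < ENNReal.ofReal (Real.sqrt Q) :=
    ha.trans_lt (by rw [← ENNReal.ofReal_one]; exact (ENNReal.ofReal_lt_ofReal_iff (by linarith)).2 hs1)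
  have hev := eventually_lt_of_limsup_lt hlt
  have hbd : ∀ᶠ k in atTop, lvlCoef a k ≤ Q ^ k := by
    filter_upwards [hev, eventually_gt_atTop 0] with k hk hk0
    have h1 := (ENNReal.ofReal_lt_ofReal_iff (by linarith)).1 hk
    have hc : 0 ≤ lvlCoef a k := Real.sqrt_nonneg _
    have hk' : (k : ℝ) ≠ 0 := by positivity
    have h2 : lvlCoef a k = (lvlCoef a k ^ (1 / (2 * (k : ℝ)))) ^ (2 * k) := by
      rw [← Real.rpow_natCast, ← Real.rpow_mul hc]
      push_cast
      rw [one_div_mul_cancel (by positivity), Real.rpow_one]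
    rw [h2]
    calc _ ≤ Real.sqrt Q ^ (2 * k) := by
          have : 0 ≤ lvlCoef a k ^ (1 / (2 * (k : ℝ))) := Real.rpow_nonneg hc _
          gcongr
      _ = _ := by rw [pow_mul, Real.sq_sqrt (by linarith)]
  refine Summable.of_norm_bounded_eventually_nat (summable_geometric_of_lt_one (by positivity) hQr) ?_
  filter_upwards [hbd] with k hk
  have hc : 0 ≤ lvlCoef a k := Real.sqrt_nonneg _
  rw [Real.norm_of_nonneg (by positivity), mul_pow]
  gcongr

theorem lvlOp_smul {H : Type*} [NormedAddCommGroup H] [NormedSpace ℂ H]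
    (a : List (Fin n) → ℂ) (X : Fin n → H →L[ℂ] H) (z : ℂ) (k : ℕ) :
    lvlOp a (fun i => z • X i) k = z ^ k • lvlOp a X k := by
  have : ∀ α : List (Fin n), wordProd (fun i => z • X i) α = z ^ α.length • wordProd X α := by
    intro α
    induction α with
    | nil => simp [wordProd]
    | cons i α ih =>
      unfold wordProd at *
      rw [List.map_cons, List.prod_cons, ih, List.map_cons, List.prod_cons, List.length_cons, pow_succ',
        smul_mul_assoc, mul_smul_comm, smul_smul]
  unfold lvlOp
  rw [Finset.smul_sum]
  refine Finset.sum_congr rfl fun w _ => ?_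
  rw [this, smul_comm, List.length_ofFn]

theorem rowNorm_S (hn : 0 < n)
    {E : Type*} [NormedAddCommGroup E] [InnerProductSpace ℂ E] [CompleteSpace E]
    (S : Fin n → E →L[ℂ] E)
    (hS : ∀ i j, ContinuousLinearMap.adjoint (S i) ∘L S j = if i = j then 1 else 0)
    (ξ : E) (hξ : ‖ξ‖ = 1) (r : ℝ) (hr0 : 0 ≤ r) :
    rowNorm (fun i => (r : ℂ) • S i) = r := by
  set Q : E →L[ℂ] E := ∑ i, S i ∘L ContinuousLinearMap.adjoint (S i) with hQ
  have h1 : ∑ i, ((r : ℂ) • S i) ∘L ContinuousLinearMap.adjoint ((r : ℂ) • S i) = ((r : ℂ) ^ 2) • Q := by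
    rw [hQ, Finset.smul_sum]
    refine Finset.sum_congr rfl fun i _ => ?_
    ext x
    change (r : ℂ) • S i (ContinuousLinearMap.adjoint ((r : ℂ) • S i) x) =
      (r : ℂ) ^ 2 • S i (ContinuousLinearMap.adjoint (S i) x)
    rw [adj_smul, map_smul, smul_smul, pow_two]
    simp only [Complex.star_def, Complex.conj_ofReal]
  have hQS : ∀ j, Q * S j = S j := by
    intro j
    rw [hQ, Finset.sum_mul]
    rw [Finset.sum_eq_single j]
    · have := hS j j
      rw [if_pos rfl] at this
      change (S j * star (S j)) * S j = _
      rw [mul_assoc]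
      change S j * (ContinuousLinearMap.adjoint (S j) ∘L S j) = _
      rw [this, mul_one]
    · intro i _ hij
      have := hS i j
      rw [if_neg hij] at this
      change (S i * star (S i)) * S j = _
      rw [mul_assoc]
      change S i * (ContinuousLinearMap.adjoint (S i) ∘L S j) = _
      rw [this, mul_zero]
    · simp
  have hQQ : Q * Q = Q := by
    conv_lhs => rw [hQ]
    rw [← hQ, hQ, Finset.mul_sum, ← hQ]
    refine (Finset.sum_congr rfl fun i _ => ?_).trans hQ.symm
    change Q * (S i * star (S i)) = S i * star (S i)
    rw [← mul_assoc, hQS]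
  have hsa : star Q = Q := by
    rw [hQ, star_sum]
    refine Finset.sum_congr rfl fun i _ => ?_
    change star (S i * star (S i)) = S i * star (S i)
    simp
  have hne : Q ≠ 0 := by
    intro h0
    have h2 := hQS ⟨0, hn⟩
    rw [h0, zero_mul] at h2
    have h3 := hS ⟨0, hn⟩ ⟨0, hn⟩
    rw [if_pos rfl, ← h2] at h3
    have h4 := congrArg (fun T : E →L[ℂ] E => ‖T ξ‖) h3
    simp [hξ] at h4
  have hnQ : ‖Q‖ = 1 := by
    have h2 := CStarRing.norm_star_mul_self (x := Q)
    rw [hsa, hQQ] at h2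
    have h3 : ‖Q‖ ≠ 0 := norm_ne_zero_iff.2 hne
    exact (mul_left_cancel₀ h3 (by rw [mul_one]; exact h2)).symm
  unfold rowNorm
  rw [h1, norm_smul, hnQ, mul_one, norm_pow, Complex.norm_real, Real.norm_of_nonneg hr0,
    Real.sqrt_sq hr0]

theorem sum_lvlOp {H : Type*} [NormedAddCommGroup H] [NormedSpace ℂ H]
    (a : List (Fin n) → ℂ) (X : Fin n → H →L[ℂ] H) (N : ℕ) :
    ∑ k ∈ Finset.range N, lvlOp a X k = ∑ α ∈ wlt n N, a α • wordProd X α := by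
  rw [sum_wlt]
  refine Finset.sum_congr rfl fun k _ => ?_
  exact sum_ofFn k (fun α => a α • wordProd X α)

theorem lvlOp_weight {H : Type*} [NormedAddCommGroup H] [NormedSpace ℂ H]
    (a : List (Fin n) → ℂ) (s : ℂ) (Z : Fin n → H →L[ℂ] H) (k : ℕ) :
    lvlOp (fun α => s ^ α.length * a α) Z k = s ^ k • lvlOp a Z k := by
  unfold lvlOp
  rw [Finset.smul_sum]
  refine Finset.sum_congr rfl fun w _ => ?_
  beta_reduce
  rw [List.length_ofFn, mul_smul]

/-- **Maximum principle / von Neumann-type inequality on row-balls.** If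
`limsup_k (∑_{|α|=k}|a_α|²)^{1/(2k)} ≤ 1`, `r ∈ [0,1)` and `‖X‖_row ≤ r`, then both
series `f(X)` and `f(rS)` converge absolutely in operator norm and
`‖f(X)‖ ≤ ‖f(rS)‖`; the extremal tuple `(rS_1,…,rS_n)` has row norm `r`. -/
theorem stmt_13 {n : ℕ} (hn : 0 < n) (a : List (Fin n) → ℂ)
    {E : Type*} [NormedAddCommGroup E] [InnerProductSpace ℂ E] [CompleteSpace E]
    (S : Fin n → E →L[ℂ] E)
    (hS : ∀ i j, ContinuousLinearMap.adjoint (S i) ∘L S j = if i = j then 1 else 0)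
    (ξ : E) (hξ : ‖ξ‖ = 1) (hvac : ∀ i, ContinuousLinearMap.adjoint (S i) ξ = 0)
    (ha : radiusInv a ≤ 1) (r : ℝ) (hr0 : 0 ≤ r) (hr1 : r < 1)
    {K : Type*} [NormedAddCommGroup K] [InnerProductSpace ℂ K] [CompleteSpace K]
    (X : Fin n → K →L[ℂ] K) (hX : rowNorm X ≤ r) :
    Summable (fun k : ℕ => ‖lvlOp a X k‖) ∧
    Summable (fun k : ℕ => ‖((r : ℂ) ^ k) • lvlOp a S k‖) ∧
    ‖∑' k : ℕ, lvlOp a X k‖ ≤ ‖∑' k : ℕ, ((r : ℂ) ^ k) • lvlOp a S k‖ ∧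
    rowNorm (fun i => (r : ℂ) • S i) = r := by
  have hX' := row_bound X r hX
  have hrS := rowNorm_S hn S hS ξ hξ r hr0
  have hS' := row_bound (fun i => (r : ℂ) • S i) r hrS.le
  have hsum := coef_summable a ha r hr0 hr1
  have s1 : Summable (fun k : ℕ => ‖lvlOp a X k‖) :=
    Summable.of_nonneg_of_le (fun _ => norm_nonneg _) (lvlOp_norm X r hr0 hX' a) hsum
  have s2 : Summable (fun k : ℕ => ‖((r : ℂ) ^ k) • lvlOp a S k‖) := by
    refine Summable.of_nonneg_of_le (fun _ => norm_nonneg _) (fun k => ?_) hsum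
    rw [← lvlOp_smul]
    exact lvlOp_norm _ r hr0 hS' a k
  refine ⟨s1, s2, ?_, hrS⟩
  have t1 := s1.of_norm.hasSum.tendsto_sum_nat.norm
  have t2 := s2.of_norm.hasSum.tendsto_sum_nat.norm
  refine le_of_tendsto_of_tendsto' t1 t2 fun N => ?_
  have hs : ∀ s : ℝ, r < s → ‖∑ k ∈ Finset.range N, lvlOp a X k‖ ≤
      ‖∑ k ∈ Finset.range N, ((s : ℂ) ^ k) • lvlOp a S k‖ := by
    intro s hrs
    have hs0 : 0 < s := hr0.trans_lt hrs
    have hsc : (s : ℂ) ≠ 0 := by exact_mod_cast hs0.ne'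
    set Y : Fin n → K →L[ℂ] K := fun i => ((s : ℂ)⁻¹) • X i with hYdef
    have hXY : X = fun i => (s : ℂ) • Y i := by
      funext i
      rw [hYdef]
      simp [smul_smul, hsc]
    have hY : ∀ h, ∑ i, ‖ContinuousLinearMap.adjoint (Y i) h‖ ^ 2 ≤ (r / s) ^ 2 * ‖h‖ ^ 2 := by
      intro h
      have e : ∀ i, ‖ContinuousLinearMap.adjoint (Y i) h‖ ^ 2
          = (s⁻¹) ^ 2 * ‖ContinuousLinearMap.adjoint (X i) h‖ ^ 2 := by
        intro i
        rw [hYdef]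
        beta_reduce
        rw [adj_smul, norm_smul, mul_pow]
        simp
      simp only [e]
      rw [← Finset.mul_sum]
      calc _ ≤ (s⁻¹) ^ 2 * (r ^ 2 * ‖h‖ ^ 2) := by gcongr; exact hX' h
        _ = _ := by ring
    have key := poly_ineq S ξ hS hξ hvac Y (r / s) (by positivity) ((div_lt_one hs0).2 hrs) hY
      (fun α => (s : ℂ) ^ α.length * a α) N
    rw [← sum_lvlOp, ← sum_lvlOp] at key
    simp only [lvlOp_weight] at key
    rw [hXY]
    simp only [lvlOp_smul]
    exact key
  have hcont : Continuous (fun s : ℝ => ‖∑ k ∈ Finset.range N, ((s : ℂ) ^ k) • lvlOp a S k‖) := by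
    fun_prop
  have hl : Tendsto (fun s : ℝ => ‖∑ k ∈ Finset.range N, ((s : ℂ) ^ k) • lvlOp a S k‖)
      (nhdsWithin r (Set.Ioi r)) (nhds ‖∑ k ∈ Finset.range N, ((r : ℂ) ^ k) • lvlOp a S k‖) :=
    (hcont.tendsto r).mono_left nhdsWithin_le_nhds
  refine ge_of_tendsto hl ?_
  filter_upwards [self_mem_nhdsWithin] with s hs'
  exact hs s hs'
end

section
/- Montel-type theorem for free holomorphic functions: Let S_1,…,S_n be isometries with pairwise orthogonal ranges and vacuum vector ξ on a complex Hilbert space E. For each m ∈ ℕ let a^{(m)} : F_n^+ → ℂ satisfy limsup_{k→∞}(∑_{|α|=k}|a^{(m)}_α|²)^{1/(2k)} ≤ 1, and for 0 ≤ r < 1 write F_m(rS) := ∑_{k=0}^∞ r^k ∑_{|α|=k} a^{(m)}_α S_α. Suppose the sequence is locally bounded: for every r ∈ [0,1), sup_{m} ‖F_m(rS)‖ < ∞. Then there exist a strictly increasing sequence of indices (m_k) and coefficients a : F_n^+ → ℂ with limsup_{k→∞}(∑_{|α|=k}|a_α|²)^{1/(2k)} ≤ 1 such that for every r ∈ [0,1),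 F_{m_k}(rS) converges in operator norm, as k → ∞, to F(rS) := ∑_{k=0}^∞ r^k ∑_{|α|=k} a_α S_α. -/
open Filter MeasureTheory
open scoped ENNReal

variable {n : ℕ}

section Helpers

variable {E : Type*} [NormedAddCommGroup E] [InnerProductSpace ℂ E] [CompleteSpace E]

lemma wordProd_cons (S : Fin n → E →L[ℂ] E) (i : Fin n) (v : List (Fin n)) (x : E) :
    wordProd S (i :: v) x = S i (wordProd S v x) := by
  simp [wordProd]

lemma wordProd_nil (S : Fin n → E →L[ℂ] E) (x : E) :
    wordProd S [] x = x := by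
  simp [wordProd]

lemma inner_gen (S : Fin n → E →L[ℂ] E)
    (hS : ∀ i j, ContinuousLinearMap.adjoint (S i) ∘L S j = if i = j then 1 else 0)
    (i j : Fin n) (x y : E) :
    inner ℂ (S i x) (S j y) = if i = j then inner ℂ x y else 0 := by
  rw [← ContinuousLinearMap.adjoint_inner_right]
  have h := congrArg (fun T : E →L[ℂ] E => T y) (hS i j)
  simp only [ContinuousLinearMap.comp_apply] at h
  rw [h]
  split_ifs <;> simp

lemma inner_word (S : Fin n → E →L[ℂ] E)
    (hS : ∀ i j, ContinuousLinearMap.adjoint (S i) ∘L S j = if i = j then 1 else 0)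
    (x y : E) : ∀ v w : List (Fin n), v.length = w.length →
    inner ℂ (wordProd S v x) (wordProd S w y) = if v = w then inner ℂ x y else 0
  | [], [], _ => by simp [wordProd_nil]
  | i :: v, j :: w, h => by
    rw [wordProd_cons, wordProd_cons, inner_gen S hS, inner_word S hS x y v w (by simpa using h)]
    by_cases h1 : i = j <;> by_cases h2 : v = w <;> simp [h1, h2]

lemma inner_vac (S : Fin n → E →L[ℂ] E)
    (hS : ∀ i j, ContinuousLinearMap.adjoint (S i) ∘L S j = if i = j then 1 else 0)
    (ξ : E) (hvac : ∀ i, ContinuousLinearMap.adjoint (S i) ξ = 0) :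
    ∀ v w : List (Fin n), v.length ≠ w.length →
    inner ℂ (wordProd S v ξ) (wordProd S w ξ) = 0
  | [], [], h => by simp at h
  | [], j :: w, _ => by
    rw [wordProd_cons, wordProd_nil, ← ContinuousLinearMap.adjoint_inner_left, hvac]; simp
  | i :: v, [], _ => by
    rw [wordProd_cons, wordProd_nil, ← ContinuousLinearMap.adjoint_inner_right, hvac]; simp
  | i :: v, j :: w, h => by
    rw [wordProd_cons, wordProd_cons, inner_gen S hS,
      inner_vac S hS ξ hvac v w (by simpa using h)]
    simp

lemma lvlOp_apply (a : List (Fin n) → ℂ) (S : Fin n → E →L[ℂ] E) (k : ℕ) (x : E) :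
    lvlOp a S k x = ∑ w : Fin k → Fin n, a (List.ofFn w) • wordProd S (List.ofFn w) x := by
  simp [lvlOp, ContinuousLinearMap.sum_apply]

lemma lvlCoef_nonneg (a : List (Fin n) → ℂ) (k : ℕ) : 0 ≤ lvlCoef a k := Real.sqrt_nonneg _

lemma norm_lvlOp_apply (S : Fin n → E →L[ℂ] E)
    (hS : ∀ i j, ContinuousLinearMap.adjoint (S i) ∘L S j = if i = j then 1 else 0)
    (a : List (Fin n) → ℂ) (k : ℕ) (x : E) :
    ‖lvlOp a S k x‖ = lvlCoef a k * ‖x‖ := by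
  have h : inner ℂ (lvlOp a S k x) (lvlOp a S k x) = (((lvlCoef a k * ‖x‖) ^ 2 : ℝ) : ℂ) := by
    rw [mul_pow, lvlCoef, Real.sq_sqrt (by positivity), lvlOp_apply, sum_inner]
    simp only [inner_sum, inner_smul_left, inner_smul_right]
    rw [Finset.sum_mul]
    push_cast
    refine Finset.sum_congr rfl fun v _ => ?_
    rw [Finset.sum_eq_single v]
    · rw [inner_word S hS x x _ _ rfl, if_pos rfl, inner_self_eq_norm_sq_to_K, ← mul_assoc,
        Complex.mul_conj, Complex.normSq_eq_norm_sq]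
      push_cast
      rfl
    · intro w _ hw
      rw [inner_word S hS x x _ _ (by simp), if_neg]
      · simp
      · intro h; exact hw (List.ofFn_injective h).symm
    · simp
  rw [inner_self_eq_norm_sq_to_K] at h
  have h2 : ‖lvlOp a S k x‖ ^ 2 = (lvlCoef a k * ‖x‖) ^ 2 := by
    apply Complex.ofReal_injective
    rw [← h]
    push_cast
    rfl
  exact (sq_eq_sq₀ (norm_nonneg _) (mul_nonneg (lvlCoef_nonneg a k) (norm_nonneg _))).1 h2

lemma norm_lvlOp_le (S : Fin n → E →L[ℂ] E)
    (hS : ∀ i j, ContinuousLinearMap.adjoint (S i) ∘L S j = if i = j then 1 else 0)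
    (a : List (Fin n) → ℂ) (k : ℕ) : ‖lvlOp a S k‖ ≤ lvlCoef a k :=
  ContinuousLinearMap.opNorm_le_bound _ (lvlCoef_nonneg a k)
    fun x => (norm_lvlOp_apply S hS a k x).le

lemma inner_lvlOp (S : Fin n → E →L[ℂ] E)
    (hS : ∀ i j, ContinuousLinearMap.adjoint (S i) ∘L S j = if i = j then 1 else 0)
    (ξ : E) (hvac : ∀ i, ContinuousLinearMap.adjoint (S i) ξ = 0)
    (a : List (Fin n) → ℂ) (k l : ℕ) (h : k ≠ l) :
    inner ℂ (lvlOp a S k ξ) (lvlOp a S l ξ) = 0 := by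
  rw [lvlOp_apply, lvlOp_apply, sum_inner]
  simp only [inner_sum, inner_smul_left, inner_smul_right]
  refine Finset.sum_eq_zero fun v _ => Finset.sum_eq_zero fun w _ => ?_
  rw [inner_vac S hS ξ hvac _ _ (by simpa using h)]
  simp

lemma rpow_root_le {x c : ℝ} (hx : 0 ≤ x) (hc : 0 ≤ c) {k : ℕ} (hk : 0 < k) :
    x ^ (1 / (2 * (k : ℝ))) ≤ c ↔ x ≤ c ^ (2 * k) := by
  have hk' : (0 : ℝ) < 2 * (k : ℝ) := by positivity
  rw [one_div, Real.rpow_inv_le_iff_of_pos hx hc hk']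
  have : (2 * (k : ℝ)) = ((2 * k : ℕ) : ℝ) := by push_cast; rfl
  rw [this, Real.rpow_natCast]

lemma radiusInv_le (b : List (Fin n) → ℂ)
    (h : ∀ r : ℝ, 0 < r → r < 1 → ∃ M : ℝ, ∀ k, r ^ k * lvlCoef b k ≤ M) :
    radiusInv b ≤ 1 := by
  refine le_of_forall_gt_imp_ge_of_dense fun c hc => ?_
  by_cases hct : c = ⊤
  · simp [hct]
  lift c to NNReal using hct
  have hc1 : (1 : ℝ) < c := by exact_mod_cast hc
  have hc0 : (0 : ℝ) < c := by linarith
  obtain ⟨M, hM⟩ := h (c : ℝ)⁻¹ (by positivity) (inv_lt_one_of_one_lt₀ hc1)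
  refine limsup_le_of_le (by isBoundedDefault) ?_
  filter_upwards [(tendsto_pow_atTop_atTop_of_one_lt hc1).eventually_ge_atTop M,
    eventually_gt_atTop 0] with k hk hk0
  rw [← ENNReal.ofReal_coe_nnreal]
  refine ENNReal.ofReal_le_ofReal ?_
  rw [rpow_root_le (lvlCoef_nonneg b k) hc0.le hk0]
  have h1 := hM k
  have hp : (0 : ℝ) < (c : ℝ) ^ k := by positivity
  rw [inv_pow, inv_mul_le_iff₀ hp] at h1
  calc lvlCoef b k ≤ (c : ℝ) ^ k * M := h1
    _ ≤ (c : ℝ) ^ k * (c : ℝ) ^ k := by gcongr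
    _ = _ := by ring

lemma summable_lvlCoef (a : List (Fin n) → ℂ) (ha : radiusInv a ≤ 1) (r : ℝ) (hr : 0 ≤ r)
    (hr1 : r < 1) : Summable fun k => r ^ k * lvlCoef a k := by
  obtain ⟨s, hs, hs1⟩ := exists_between hr1
  have hs0 : 0 < s := by linarith
  set c : ℝ := Real.sqrt s⁻¹ with hcdef
  have hcsq : c ^ 2 = s⁻¹ := Real.sq_sqrt (by positivity)
  have hc1 : 1 < c := by
    rw [hcdef, Real.lt_sqrt (by norm_num)]
    simpa using (one_lt_inv₀ hs0).2 hs1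
  have hev : ∀ᶠ k : ℕ in atTop,
      ENNReal.ofReal (lvlCoef a k ^ (1 / (2 * (k : ℝ)))) < ENNReal.ofReal c := by
    refine eventually_lt_of_limsup_lt (lt_of_le_of_lt ha ?_) (by isBoundedDefault)
    simpa using hc1
  have hq : r / s < 1 := (div_lt_one hs0).2 hs
  refine Summable.of_norm_bounded_eventually_nat
    (summable_geometric_of_lt_one (div_nonneg hr hs0.le) hq) ?_
  filter_upwards [hev, eventually_gt_atTop 0] with k hk hk0
  have h1 := (rpow_root_le (lvlCoef_nonneg a k) (by linarith) hk0).1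
    (ENNReal.ofReal_lt_ofReal_iff (by linarith) |>.1 hk).le
  rw [pow_mul, hcsq] at h1
  rw [Real.norm_of_nonneg (mul_nonneg (pow_nonneg hr k) (lvlCoef_nonneg a k)), div_eq_mul_inv,
    mul_pow]
  exact mul_le_mul_of_nonneg_left h1 (pow_nonneg hr k)

lemma norm_term_le (S : Fin n → E →L[ℂ] E)
    (hS : ∀ i j, ContinuousLinearMap.adjoint (S i) ∘L S j = if i = j then 1 else 0)
    (a : List (Fin n) → ℂ) (r : ℝ) (hr : 0 ≤ r) (k : ℕ) :
    ‖((r : ℂ) ^ k) • lvlOp a S k‖ ≤ r ^ k * lvlCoef a k := by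
  rw [norm_smul, norm_pow, Complex.norm_real, Real.norm_of_nonneg hr]
  exact mul_le_mul_of_nonneg_left (norm_lvlOp_le S hS a k) (pow_nonneg hr k)

lemma cauchy_est (S : Fin n → E →L[ℂ] E)
    (hS : ∀ i j, ContinuousLinearMap.adjoint (S i) ∘L S j = if i = j then 1 else 0)
    (ξ : E) (hξ : ‖ξ‖ = 1) (hvac : ∀ i, ContinuousLinearMap.adjoint (S i) ξ = 0)
    (a : List (Fin n) → ℂ) (ha : radiusInv a ≤ 1) (r : ℝ) (hr : 0 ≤ r) (hr1 : r < 1) (k : ℕ) :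
    r ^ k * lvlCoef a k ≤ ‖∑' k : ℕ, ((r : ℂ) ^ k) • lvlOp a S k‖ := by
  have hsum : Summable fun k : ℕ => ((r : ℂ) ^ k) • lvlOp a S k :=
    Summable.of_norm_bounded (summable_lvlCoef a ha r hr hr1) (norm_term_le S hS a r hr)
  set F := ∑' k : ℕ, ((r : ℂ) ^ k) • lvlOp a S k with hF
  have h1 : HasSum (fun l : ℕ => inner ℂ (lvlOp a S k ξ) ((((r : ℂ) ^ l) • lvlOp a S l) ξ))
      (inner ℂ (lvlOp a S k ξ) (F ξ)) :=
    (hsum.hasSum.mapL ((innerSL ℂ (lvlOp a S k ξ)) ∘L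
      (ContinuousLinearMap.apply ℂ E ξ)))
  have h2 := hasSum_single (f := fun l : ℕ =>
    inner ℂ (lvlOp a S k ξ) ((((r : ℂ) ^ l) • lvlOp a S l) ξ)) k (by
      intro l hl
      simp only [ContinuousLinearMap.smul_apply, inner_smul_right]
      rw [inner_lvlOp S hS ξ hvac a k l hl.symm, mul_zero])
  have h3 := h1.unique h2
  have hn : ‖lvlOp a S k ξ‖ = lvlCoef a k := by rw [norm_lvlOp_apply S hS, hξ, mul_one]
  have h4 : ‖inner ℂ (lvlOp a S k ξ) (F ξ)‖ = r ^ k * lvlCoef a k * lvlCoef a k := by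
    rw [h3, ContinuousLinearMap.smul_apply, inner_smul_right, inner_self_eq_norm_sq_to_K, hn]
    rw [norm_mul, norm_pow, Complex.norm_real, Real.norm_of_nonneg hr, norm_pow]
    have : ‖((lvlCoef a k : ℝ) : ℂ)‖ = lvlCoef a k := by
      rw [Complex.norm_real, Real.norm_of_nonneg (lvlCoef_nonneg a k)]
    erw [this]
    ring
  have h5 : ‖inner ℂ (lvlOp a S k ξ) (F ξ)‖ ≤ lvlCoef a k * ‖F‖ := by
    refine (norm_inner_le_norm _ _).trans ?_
    rw [hn]
    refine mul_le_mul_of_nonneg_left ?_ (lvlCoef_nonneg a k)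
    simpa [hξ] using F.le_opNorm ξ
  rw [h4] at h5
  rcases (lvlCoef_nonneg a k).eq_or_lt with h0 | h0
  · rw [← h0, mul_zero]; exact norm_nonneg _
  · rw [mul_comm] at h5
    exact le_of_mul_le_mul_left h5 h0

lemma norm_le_lvlCoef (a : List (Fin n) → ℂ) (l : List (Fin n)) :
    ‖a l‖ ≤ lvlCoef a l.length := by
  refine Real.le_sqrt_of_sq_le ?_
  have := Finset.single_le_sum (f := fun w : Fin l.length → Fin n => ‖a (List.ofFn w)‖ ^ 2)
    (fun _ _ => by positivity) (Finset.mem_univ l.get)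
  simpa using this

end Helpers

/-- **Montel-type theorem for free holomorphic functions.** If each `a^{(m)}` satisfies the
Hadamard bound `limsup ≤ 1` and the family is locally bounded
(`sup_m ‖F_m(rS)‖ < ∞` for every `r ∈ [0,1)`), then there are a subsequence `(m_k)` and
limit coefficients `b` satisfying the Hadamard bound such that `F_{m_k}(rS) → F_b(rS)`
in operator norm for every `r ∈ [0,1)`. -/
theorem stmt_18 {n : ℕ} (hn : 0 < n)
    {E : Type*} [NormedAddCommGroup E] [InnerProductSpace ℂ E] [CompleteSpace E]
    (S : Fin n → E →L[ℂ] E)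
    (hS : ∀ i j, ContinuousLinearMap.adjoint (S i) ∘L S j = if i = j then 1 else 0)
    (ξ : E) (hξ : ‖ξ‖ = 1) (hvac : ∀ i, ContinuousLinearMap.adjoint (S i) ξ = 0)
    (a : ℕ → List (Fin n) → ℂ) (ha : ∀ m, radiusInv (a m) ≤ 1)
    (hbdd : ∀ r : ℝ, 0 ≤ r → r < 1 → ∃ M : ℝ,
      ∀ m : ℕ, ‖∑' k : ℕ, ((r : ℂ) ^ k) • lvlOp (a m) S k‖ ≤ M) :
    ∃ φ : ℕ → ℕ, StrictMono φ ∧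
      ∃ b : List (Fin n) → ℂ, radiusInv b ≤ 1 ∧
        ∀ r : ℝ, 0 ≤ r → r < 1 →
          Filter.Tendsto (fun j : ℕ => ∑' k : ℕ, ((r : ℂ) ^ k) • lvlOp (a (φ j)) S k)
            Filter.atTop (nhds (∑' k : ℕ, ((r : ℂ) ^ k) • lvlOp b S k)) := by
  have key : ∀ r : ℝ, 0 ≤ r → r < 1 → ∃ M : ℝ, ∀ m k : ℕ, r ^ k * lvlCoef (a m) k ≤ M := by
    intro r hr hr1
    obtain ⟨M, hM⟩ := hbdd r hr hr1
    exact ⟨M, fun m k => (cauchy_est S hS ξ hξ hvac (a m) (ha m) r hr hr1 k).trans (hM m)⟩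
  obtain ⟨M, hM⟩ := key (1 / 2) (by norm_num) (by norm_num)
  have hcomp : IsCompact (Set.univ.pi fun l : List (Fin n) =>
      Metric.closedBall (0 : ℂ) (2 ^ l.length * M)) :=
    isCompact_univ_pi fun l => isCompact_closedBall _ _
  have hmem : ∀ m, a m ∈ (Set.univ.pi fun l : List (Fin n) =>
      Metric.closedBall (0 : ℂ) (2 ^ l.length * M)) := by
    intro m l _
    rw [mem_closedBall_zero_iff]
    refine (norm_le_lvlCoef (a m) l).trans ?_
    have h1 := hM m l.length
    rwa [one_div, inv_pow, inv_mul_le_iff₀ (by positivity)] at h1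
  obtain ⟨b, -, φ, hφ, hlim⟩ := hcomp.tendsto_subseq hmem
  have hlim' : ∀ l, Tendsto (fun j => a (φ j) l) atTop (nhds (b l)) := tendsto_pi_nhds.1 hlim
  have hcoef : ∀ k, Tendsto (fun j => lvlCoef (a (φ j)) k) atTop (nhds (lvlCoef b k)) := by
    intro k
    refine Tendsto.sqrt ?_
    exact tendsto_finsetSum _ fun w _ => ((hlim' _).norm.pow 2)
  refine ⟨φ, hφ, b, ?_, ?_⟩
  · refine radiusInv_le b fun r hr hr1 => ?_
    obtain ⟨M', hM'⟩ := key r hr.le hr1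
    exact ⟨M', fun k => le_of_tendsto ((hcoef k).const_mul (r ^ k))
      (Eventually.of_forall fun j => hM' (φ j) k)⟩
  · intro r hr hr1
    obtain ⟨s, hs, hs1⟩ := exists_between hr1
    have hs0 : 0 < s := by linarith
    obtain ⟨M', hM'⟩ := key s hs0.le hs1
    refine tendsto_tsum_of_dominated_convergence (bound := fun k : ℕ => (r / s) ^ k * M')
      ((summable_geometric_of_lt_one (div_nonneg hr hs0.le) ((div_lt_one hs0).2 hs)).mul_right M')
      ?_ ?_
    · intro k
      refine Tendsto.const_smul ?_ _
      exact tendsto_finsetSum _ fun w _ => (hlim' _).smul_const _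
    · refine Eventually.of_forall fun j k => ?_
      refine (norm_term_le S hS _ r hr k).trans ?_
      have : r ^ k = (r / s) ^ k * s ^ k := by
        rw [← mul_pow, div_mul_cancel₀ _ hs0.ne']
      rw [this, mul_assoc]
      exact mul_le_mul_of_nonneg_left (hM' (φ j) k) (by positivity)
end
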